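/- Let t = 2t' be an even positive integer. For any complex numbers y and z, the following identity of formal power series in x and y holds: Σ_{λ ∈ SC} δ_λ x^{|λ|} ∏_{h ∈ H_t(λ)} (y - yzt/(h ε_h)) = ∏_{k≥1} [(1-x^{2kt})^{t'}/(1+x^k)] · (1-y^{2k}x^{2kt})^{(z^2-1)t'}, where the sum ranges over all self-conjugate partitions λ. -/

import Mathlib

/-!
Statement 2 (Theorem `genscpair`, even case): for `t = 2t'` an even positive
integer and complex numbers `y`, `z`,
Σ_{λ ∈ SC} δ_λ x^{|λ|} ∏_{h ∈ H_t(λ)} (y - yzt/(h ε_h))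
  = ∏_{k≥1} [(1-x^{2kt})^{t'}/(1+x^k)] · (1-y^{2k}x^{2kt})^{(z²-1)t'},
where the sum ranges over self-conjugate partitions.
-/

noncomputable section

open PowerSeries

/-- Product (pi) topology on formal power series. -/
instance {R : Type*} [TopologicalSpace R] : TopologicalSpace (PowerSeries R) :=
  inferInstanceAs (TopologicalSpace ((Unit →₀ ℕ) → R))

/-- The hook length of the box `c = (i, j)` (0-indexed) of a Young diagram. -/
def hookLen (μ : YoungDiagram) (c : ℕ × ℕ) : ℕ :=
  μ.rowLen c.1 + μ.colLen c.2 - c.1 - c.2 - 1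

/-- The Durfee length: the number of diagonal cells. -/
def durfee (μ : YoungDiagram) : ℕ :=
  (μ.cells.filter fun c => c.1 = c.2).card

/-- `ε` of a box: `-1` if strictly above the principal diagonal, `1` otherwise. -/
def eps (c : ℕ × ℕ) : ℂ := if c.2 < c.1 then (-1 : ℂ) else 1

/-- Generalized binomial coefficient `binom(z, k) = z(z-1)⋯(z-k+1)/k!`. -/
def cchoose (z : ℂ) (k : ℕ) : ℂ := (∏ i ∈ Finset.range k, (z - i)) / (k.factorial : ℂ)

/-- The complex power `f^z = Σ_k binom(z,k) (f-1)^k` of a power series with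
constant coefficient `1`. -/
def cpow (f : PowerSeries ℂ) (z : ℂ) : PowerSeries ℂ :=
  ∑' k : ℕ, PowerSeries.C (R := ℂ) (cchoose z k) * (f - 1) ^ k


section core
variable {R : Type*} [CommRing R]

/-- Toeplitz entries for the symbol `a(u) (1 - 1/u)^j`. -/
def Tm (a : PowerSeries R) : ℕ → ℕ → ℕ → R
  | 0, s, t => if t ≤ s then coeff (s - t) a else 0
  | j + 1, s, t => Tm a j s t - Tm a j (s + 1) t

def Zm (a d : PowerSeries R) (j s t : ℕ) : R :=
  ∑ r ∈ Finset.range (s + 1), coeff (s - r) d * Tm a j r t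

lemma Zm_zero (a d : PowerSeries R) (h : d * a = 1) (s t : ℕ) :
    Zm a d 0 s t = if s = t then 1 else 0 := by
  unfold Zm
  simp only [Tm]
  rcases Nat.lt_or_ge s t with hst | hst
  · rw [if_neg (by omega)]
    apply Finset.sum_eq_zero
    intro r hr
    rw [Finset.mem_range] at hr
    rw [if_neg (by omega), mul_zero]
  · obtain ⟨e, rfl⟩ := Nat.exists_eq_add_of_le hst
    rw [show t + e + 1 = t + (e + 1) by ring, Finset.sum_range_add]
    rw [Finset.sum_eq_zero, zero_add]
    · have := congrArg (coeff e) h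
      rw [mul_comm, coeff_mul, Finset.Nat.sum_antidiagonal_eq_sum_range_succ
        (fun i j => coeff i a * coeff j d), coeff_one] at this
      have h0 : (if t + e = t then (1 : R) else 0) = if e = 0 then 1 else 0 := by simp
      rw [h0, ← this]
      apply Finset.sum_congr rfl
      intro r hr
      rw [Finset.mem_range] at hr
      rw [if_pos (by omega), mul_comm]
      congr 3 <;> omega
    · intro r hr
      rw [Finset.mem_range] at hr
      rw [if_neg (by omega), mul_zero]

lemma Zm_succ (a d : PowerSeries R) (j s t : ℕ) :
    Zm a d (j + 1) s t = Zm a d j s t - Zm a d j (s + 1) t + coeff (s + 1) d * Tm a j 0 t := by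
  unfold Zm
  simp only [Tm, mul_sub, Finset.sum_sub_distrib]
  rw [Finset.sum_range_succ' _ (s + 1)]
  simp
  ring

lemma Zm_dvd (x : R) (a d : PowerSeries R) (h : d * a = 1) (hd : ∀ j, x ^ j ∣ coeff j d)
    (j s t : ℕ) (hts : t ≤ s) : x ^ (s + 1) ∣ Zm a d j s t - if s = t then 1 else 0 := by
  induction j generalizing s t with
  | zero => rw [Zm_zero a d h]; simp
  | succ j ih =>
    rw [Zm_succ]
    have h1 := ih s t hts
    have h2 := ih (s + 1) t (by omega)
    rw [if_neg (by omega), sub_zero] at h2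
    have h3 : x ^ (s + 1) ∣ coeff (s + 1) d * Tm a j 0 t := Dvd.dvd.mul_right (hd _) _
    have h4 := (pow_dvd_pow x (Nat.le_succ (s + 1))).trans h2
    have := (h1.sub h4).add h3
    convert this using 1
    ring

def DT (a : PowerSeries R) (j M : ℕ) : R := (Matrix.of fun s t : Fin M => Tm a j s t).det

def lowM (M : ℕ) (f : PowerSeries R) : Matrix (Fin M) (Fin M) R :=
  Matrix.of fun s t => if (t : ℕ) ≤ s then coeff ((s : ℕ) - t) f else 0

lemma det_lowM (M : ℕ) (f : PowerSeries R) (hf : coeff 0 f = 1) : (lowM M f).det = 1 := by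
  rw [Matrix.det_of_isLowerTriangular]
  · apply Finset.prod_eq_one
    intro i _
    simp only [lowM, Matrix.of_apply, le_refl, if_true, Nat.sub_self, hf]
  · intro i j hij
    have : i < j := hij
    simp only [lowM, Matrix.of_apply]
    rw [if_neg (by simpa using this)]

lemma sum_fin_le (M : ℕ) (s : Fin M) (g : ℕ → R) :
    ∑ r : Fin M, (if (r : ℕ) ≤ s then g r else 0) = ∑ r ∈ Finset.range (s + 1), g r := by
  rw [Fin.sum_univ_eq_sum_range (fun r => if r ≤ (s : ℕ) then g r else 0) M]
  rw [← Finset.sum_filter]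
  apply Finset.sum_congr _ (fun _ _ => rfl)
  ext r
  have := s.2
  simp only [Finset.mem_filter, Finset.mem_range]
  omega

lemma lowM_mul_apply (M : ℕ) (f : PowerSeries R) (V : ℕ → ℕ → R) (s t : Fin M) :
    (lowM M f * Matrix.of fun s t : Fin M => V s t) s t =
      ∑ r ∈ Finset.range (s + 1), coeff (s - r) f * V r t := by
  rw [Matrix.mul_apply, ← sum_fin_le M s (fun r => coeff (s - r) f * V r t)]
  apply Finset.sum_congr rfl
  intro r _
  simp only [lowM, Matrix.of_apply, ite_mul, zero_mul]

lemma det_Zm (a d : PowerSeries R) (hd0 : coeff 0 d = 1) (j M : ℕ) :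
    (Matrix.of fun s t : Fin M => Zm a d j s t).det = DT a j M := by
  have : (Matrix.of fun s t : Fin M => Zm a d j s t) =
      lowM M d * Matrix.of fun s t : Fin M => Tm a j s t := by
    ext s t
    rw [lowM_mul_apply]
    rfl
  rw [this, Matrix.det_mul, det_lowM _ _ hd0, one_mul, DT]

/-- congruence of determinants -/
lemma det_dvd {n : Type*} [Fintype n] [DecidableEq n] (c : R) (A B : Matrix n n R)
    (h : ∀ i j, c ∣ A i j - B i j) : c ∣ A.det - B.det := by
  rw [← Ideal.mem_span_singleton, ← Ideal.Quotient.mk_eq_mk_iff_sub_mem, RingHom.map_det,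
    RingHom.map_det]
  congr 1
  ext i j
  simp only [RingHom.mapMatrix_apply, Matrix.map_apply]
  rw [Ideal.Quotient.mk_eq_mk_iff_sub_mem, Ideal.mem_span_singleton]
  exact h i j

lemma det_last_row {M : ℕ} (A : Matrix (Fin (M + 1)) (Fin (M + 1)) R)
    (h : ∀ j : Fin M, A (Fin.last M) j.castSucc = 0) :
    A.det = A (Fin.last M) (Fin.last M) * (A.submatrix Fin.castSucc Fin.castSucc).det := by
  rw [Matrix.det_succ_row A (Fin.last M), Fin.sum_univ_castSucc]
  rw [Finset.sum_eq_zero]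
  · simp
  · intro j _
    rw [h]; ring

lemma det_last_col {M : ℕ} (A : Matrix (Fin (M + 1)) (Fin (M + 1)) R)
    (h : ∀ j : Fin M, A j.castSucc (Fin.last M) = 0) :
    A.det = A (Fin.last M) (Fin.last M) * (A.submatrix Fin.castSucc Fin.castSucc).det := by
  rw [← Matrix.det_transpose, det_last_row _ (by simpa using h)]
  rw [← Matrix.det_transpose]
  rfl

lemma DT_succ (x : R) (a d : PowerSeries R) (h : d * a = 1) (hd0 : coeff 0 d = 1)
    (hd : ∀ j, x ^ j ∣ coeff j d) (j M : ℕ) :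
    x ^ (M + 1) ∣ DT a (j + 1) M - (∑ i ∈ Finset.range (M + 1), coeff i d) * DT a j M := by
  let V : ℕ → ℕ → R := fun s t => if t < M then Tm a j s t else 1
  let VM : Matrix (Fin (M + 1)) (Fin (M + 1)) R := Matrix.of fun s t => V s t
  -- first evaluation
  have e1 : VM.det = DT a (j + 1) M := by
    let W : Matrix (Fin (M + 1)) (Fin (M + 1)) R :=
      Matrix.of fun s t => if (s : ℕ) < M then V s t - V (s + 1) t else V s t
    have hW : W = (lowM (M + 1) (1 - X)).transpose * VM := by
      ext s t
      rw [Matrix.mul_apply]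
      have hc : ∀ r : Fin (M + 1), (lowM (M + 1) (1 - X : PowerSeries R)).transpose s r * VM r t =
          (if r = s then V r t else 0) - (if (r : ℕ) = s + 1 then V r t else 0) := by
        intro r
        simp only [lowM, Matrix.transpose_apply, Matrix.of_apply, VM, map_sub, coeff_one, coeff_X]
        have : (r = s) = ((r : ℕ) = s) := by simp [Fin.ext_iff]
        simp only [this]
        split_ifs <;> first | omega | simp
      simp only [hc, Finset.sum_sub_distrib]
      rw [Finset.sum_ite_eq' Finset.univ s (fun r => V r t), if_pos (Finset.mem_univ _),
        Fin.sum_univ_eq_sum_range (fun r => if r = (s : ℕ) + 1 then V r t else 0) (M + 1),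
        Finset.sum_ite_eq']
      simp only [W, Matrix.of_apply, Finset.mem_range]
      split_ifs <;> first | omega | simp
    have : W.det = VM.det := by
      rw [hW, Matrix.det_mul, Matrix.det_transpose, det_lowM _ _ (by simp), one_mul]
    rw [← this, det_last_col]
    · have h1 : W (Fin.last M) (Fin.last M) = 1 := by simp [W, V]
      rw [h1, one_mul, DT]
      congr 1
      ext s t
      simp [W, V, Tm]
    · intro s
      simp [W, V]
  let U : Matrix (Fin (M + 1)) (Fin (M + 1)) R :=
    Matrix.of fun s t => if (t : ℕ) < M then Zm a d j s t else
      ∑ r ∈ Finset.range (s + 1), coeff (s - r) d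
  have e2 : U.det = VM.det := by
    have : U = lowM (M + 1) d * VM := by
      ext s t
      rw [lowM_mul_apply]
      simp only [U, V, Matrix.of_apply]
      split_ifs
      · rfl
      · simp
    rw [this, Matrix.det_mul, det_lowM _ _ hd0, one_mul]
  let U' : Matrix (Fin (M + 1)) (Fin (M + 1)) R :=
    Matrix.of fun s t => if (s : ℕ) = M ∧ (t : ℕ) < M then 0 else U s t
  have e3 : U'.det = (∑ i ∈ Finset.range (M + 1), coeff i d) * DT a j M := by
    rw [det_last_row]
    · congr 1
      · simp only [U', U, Matrix.of_apply, Fin.val_last, lt_irrefl, and_false, if_false]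
        rw [← Finset.sum_range_reflect]
        apply Finset.sum_congr rfl
        intro r hr
        rw [Finset.mem_range] at hr
        congr 1
        congr 1
        omega
      · rw [← det_Zm a d hd0]
        congr 1
        ext s t
        have := s.2
        simp [U', U, this.ne]
    · intro t
      simp [U']
  rw [← e1, ← e2, ← e3]
  apply det_dvd
  intro s t
  simp only [U', Matrix.of_apply]
  split_ifs with hs
  · obtain ⟨hs, ht⟩ := hs
    simp only [U, Matrix.of_apply, if_pos ht, sub_zero]
    have := Zm_dvd x a d h hd j s t (by omega)
    rw [if_neg (by omega), sub_zero, hs] at this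
    rwa [hs]
  · simp

lemma DT_zero (a : PowerSeries R) (ha : coeff 0 a = 1) (M : ℕ) : DT a 0 M = 1 :=
  det_lowM M a ha

lemma DT_pow (x σ : R) (a d : PowerSeries R) (h : d * a = 1) (hd0 : coeff 0 d = 1)
    (ha0 : coeff 0 a = 1)
    (hd : ∀ j, x ^ j ∣ coeff j d) (M : ℕ)
    (hσ : x ^ (M + 1) ∣ (∑ i ∈ Finset.range (M + 1), coeff i d) - σ) (j : ℕ) :
    x ^ (M + 1) ∣ DT a j M - σ ^ j := by
  induction j with
  | zero => simp [DT_zero a ha0]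
  | succ j ih =>
    have h1 := DT_succ x a d h hd0 hd j M
    have h2 : x ^ (M + 1) ∣ ((∑ i ∈ Finset.range (M + 1), coeff i d) - σ) * DT a j M +
      σ * (DT a j M - σ ^ j) := (hσ.mul_right _).add (ih.mul_left _)
    convert h1.add h2 using 1
    ring

lemma fin_strictMono_le {K : ℕ} (f : Fin K → ℕ) (hf : StrictMono f) (i : Fin K) :
    (i : ℕ) ≤ f i := by
  obtain ⟨i, hi⟩ := i
  induction i with
  | zero => simp
  | succ i ih =>
    have h1 := ih (by omega)
    have h2 : f ⟨i, by omega⟩ < f ⟨i + 1, hi⟩ := hf (by simp)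
    simp only at *
    omega

/-- minors of `Zm` along a strictly increasing sequence -/
lemma minor_Zm (x : R) (a d : PowerSeries R) (h : d * a = 1) (hd : ∀ j, x ^ j ∣ coeff j d)
    (hd0 : coeff 0 d = 1) (j n k : ℕ) (f : Fin (n + k) → ℕ) (hf : StrictMono f)
    (hfn : ∀ i : Fin (n + k), (i : ℕ) < n → f i = i) :
    x ^ (n + 1) ∣ (Matrix.of fun s t => Zm a d j (f s) (f t)).det - DT a j n := by
  induction k with
  | zero =>
    rw [← det_Zm a d hd0]
    have : (Matrix.of fun s t => Zm a d j (f s) (f t)) =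
      (Matrix.of fun s t : Fin (n + 0) => Zm a d j s t) := by
      ext s t
      simp only [Matrix.of_apply]
      rw [hfn s s.2, hfn t t.2]
    rw [this]
    simp
  | succ k ih =>
    have h1 := ih (fun i => f i.castSucc) (fun i i' hii => hf (by simpa using hii))
      (fun i hi => by rw [hfn _ (by simpa using hi)]; simp)
    let A : Matrix (Fin (n + k + 1)) (Fin (n + k + 1)) R :=
      Matrix.of fun s t => Zm a d j (f s) (f t)
    let A' : Matrix (Fin (n + k + 1)) (Fin (n + k + 1)) R :=
      Matrix.of fun s t => if s = Fin.last _ then (if s = t then 1 else 0) else A s t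
    have h2 : A'.det = (Matrix.of fun s t : Fin (n + k) =>
        Zm a d j (f s.castSucc) (f t.castSucc)).det := by
      rw [det_last_row]
      · simp only [A', Matrix.of_apply, if_true, one_mul]
        congr 1
        ext s t
        simp [A, (Fin.castSucc_lt_last s).ne]
      · intro t
        simp [A', (Fin.castSucc_lt_last t).ne']
    have h3 : x ^ (n + 1) ∣ A.det - A'.det := by
      apply det_dvd
      intro s t
      simp only [A', Matrix.of_apply]
      split_ifs with hs hst
      · subst hst
        have := Zm_dvd x a d h hd j (f s) (f s) le_rfl
        simp only [if_true] at this
        refine (pow_dvd_pow x ?_).trans this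
        have := fin_strictMono_le f hf s
        rw [hs] at this ⊢
        simp at this
        omega
      · have hlt : f t < f s := hf (by rw [hs] at hst ⊢; exact lt_of_le_of_ne (Fin.le_last t) (Ne.symm hst))
        have := Zm_dvd x a d h hd j (f s) (f t) hlt.le
        rw [if_neg hlt.ne'] at this
        refine (pow_dvd_pow x ?_).trans this
        have := fin_strictMono_le f hf s
        rw [hs] at this ⊢
        simp at this
        omega
      · simp
    have := h3.add (h2 ▸ h1)
    rwa [sub_add_sub_cancel] at this
end core


section coreB
variable {R : Type*} [CommRing R]

lemma lowM_mul (P : ℕ) (f g : PowerSeries R) : lowM P (f * g) = lowM P f * lowM P g := by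
  ext s t
  have h := lowM_mul_apply P f (fun s t => if t ≤ s then coeff (s - t) g else 0) s t
  have h' : lowM P g = Matrix.of fun s t : Fin P =>
    (if (t : ℕ) ≤ s then coeff ((s : ℕ) - t) g else 0) := rfl
  rw [h', h]
  simp only [lowM, Matrix.of_apply]
  split_ifs with hts
  · obtain ⟨e, he⟩ := Nat.exists_eq_add_of_le hts
    rw [he, show (t : ℕ) + e + 1 = t + (e + 1) by ring, Finset.sum_range_add]
    rw [Finset.sum_eq_zero, zero_add]
    · rw [mul_comm, coeff_mul, Finset.Nat.sum_antidiagonal_eq_sum_range_succ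
        (fun i j => coeff i g * coeff j f)]
      rw [show (t : ℕ) + e - t = e by omega]
      apply Finset.sum_congr rfl
      intro r hr
      rw [Finset.mem_range] at hr
      rw [if_pos (by omega), mul_comm]
      congr 3 <;> omega
    · intro r hr
      rw [Finset.mem_range] at hr
      rw [if_neg (by omega), mul_zero]
  · symm
    apply Finset.sum_eq_zero
    intro r hr
    rw [Finset.mem_range] at hr
    rw [if_neg (by omega), mul_zero]

lemma lowM_one (P : ℕ) : lowM P (1 : PowerSeries R) = 1 := by
  ext s t
  simp only [lowM, Matrix.of_apply, coeff_one, Matrix.one_apply, Fin.ext_iff]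
  split_ifs <;> first | rfl | omega

lemma lowM_pow (P : ℕ) (f : PowerSeries R) (m : ℕ) : lowM P (f ^ m) = lowM P f ^ m := by
  induction m with
  | zero => simp [lowM_one]
  | succ m ih => rw [pow_succ, lowM_mul, ih, pow_succ]

def Xdiag (P : ℕ) (x : R) : Matrix (Fin P) (Fin P) R := Matrix.diagonal fun s => x ^ (s : ℕ)

lemma Xdiag_lowM (P : ℕ) (x : R) (f : PowerSeries R) :
    Xdiag P x * lowM P f = lowM P (rescale x f) * Xdiag P x := by
  ext s t
  simp only [Xdiag, Matrix.diagonal_mul, Matrix.mul_diagonal, lowM, Matrix.of_apply, coeff_rescale]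
  split_ifs with h
  · rw [mul_right_comm, ← pow_add, Nat.sub_add_cancel h]
  · simp

/-- geometric series -/
def geo (c : R) : PowerSeries R := PowerSeries.mk fun j => c ^ j

lemma geo_mul (c : R) : (1 - PowerSeries.C c * X) * geo c = 1 := by
  ext j
  rw [sub_mul, one_mul, mul_assoc, map_sub, coeff_C_mul, coeff_one]
  cases j with
  | zero => simp [geo]
  | succ j => rw [coeff_succ_X_mul]; simp [geo, pow_succ, mul_comm]

lemma rescale_geo (x c : R) : rescale x (geo c) = geo (x * c) := by
  ext j
  simp [geo, coeff_rescale, mul_pow]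

def aP (x : R) (m K : ℕ) : PowerSeries R := ∏ k ∈ Finset.range K, geo (x ^ (k + 1)) ^ m
def dP (x : R) (m K : ℕ) : PowerSeries R :=
  ∏ k ∈ Finset.range K, (1 - PowerSeries.C (x ^ (k + 1)) * X) ^ m

lemma dP_mul_aP (x : R) (m K : ℕ) : dP x m K * aP x m K = 1 := by
  unfold dP aP
  rw [← Finset.prod_mul_distrib]
  apply Finset.prod_eq_one
  intro k _
  rw [← mul_pow, geo_mul, one_pow]

lemma coeff_zero_aP (x : R) (m K : ℕ) : coeff 0 (aP x m K) = 1 := by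
  rw [coeff_zero_eq_constantCoeff_apply, aP, map_prod]
  apply Finset.prod_eq_one
  intro k _
  rw [map_pow, ← coeff_zero_eq_constantCoeff_apply]
  simp [geo]

lemma coeff_zero_dP (x : R) (m K : ℕ) : coeff 0 (dP x m K) = 1 := by
  rw [coeff_zero_eq_constantCoeff_apply, dP, map_prod]
  apply Finset.prod_eq_one
  intro k _
  simp

/-- commuting the diagonal past the lower-triangular factor -/
lemma Xdiag_A (P : ℕ) (x : R) (m K : ℕ) :
    Xdiag P x * lowM P (geo 1 ^ m) * lowM P (aP x m K) =
      lowM P (aP x m K) * lowM P (geo (x ^ (K + 1)) ^ m) * Xdiag P x := by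
  rw [mul_assoc, ← lowM_mul, Xdiag_lowM, ← lowM_mul]
  congr 2
  rw [aP, map_mul, map_pow, rescale_geo, map_prod]
  simp only [map_pow, rescale_geo]
  have h1 := Finset.prod_range_succ (fun k => geo (x ^ (k + 1)) ^ m) K
  rw [← h1, Finset.prod_range_succ']
  rw [mul_comm]
  congr 1
  · apply Finset.prod_congr rfl
    intro k _
    rw [← pow_succ']
  · simp

lemma geo_pow_cong (c : R) (m j : ℕ) : c ∣ coeff j (geo c ^ m - 1) := by
  induction m generalizing j with
  | zero => simp
  | succ m ih =>
    have : geo c ^ (m + 1) - 1 = (geo c ^ m - 1) * geo c + (geo c - 1) := by ring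
    rw [this, map_add, coeff_mul]
    apply dvd_add
    · apply Finset.dvd_sum
      intro p _
      exact (ih _).mul_right _
    · rw [map_sub, coeff_one]
      cases j with
      | zero => simp [geo]
      | succ j => simp [geo, pow_succ]

/-- upper shift powers acting on a lower Toeplitz matrix give `Tm`. -/
lemma upper_pow (P : ℕ) (a : PowerSeries R) (j : ℕ) (s t : Fin P) (hs : (s : ℕ) + j < P) :
    ((lowM P (1 - X : PowerSeries R)).transpose ^ j * lowM P a) s t = Tm a j s t := by
  induction j generalizing s with
  | zero => simp [lowM, Tm]
  | succ j ih =>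
    rw [pow_succ', mul_assoc, Matrix.mul_apply]
    set V := (lowM P (1 - X : PowerSeries R)).transpose ^ j * lowM P a with hV
    have hc : ∀ r : Fin P, (lowM P (1 - X : PowerSeries R)).transpose s r * V r t =
        (if r = s then V r t else 0) - (if r = ⟨s + 1, by omega⟩ then V r t else 0) := by
      intro r
      simp only [lowM, Matrix.transpose_apply, Matrix.of_apply, map_sub, coeff_one, coeff_X]
      have : (r = s) = ((r : ℕ) = s) := by simp [Fin.ext_iff]
      simp only [this, Fin.ext_iff]
      split_ifs <;> first | omega | simp
    simp only [hc, Finset.sum_sub_distrib]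
    rw [Finset.sum_ite_eq', Finset.sum_ite_eq', if_pos (Finset.mem_univ _),
      if_pos (Finset.mem_univ _), ih s (by omega), ih ⟨s + 1, by omega⟩ (by simp; omega)]
    rfl

def Ymat (P : ℕ) (x : R) (m K : ℕ) : Matrix (Fin P) (Fin P) R :=
  lowM P (dP x m K) * ((lowM P ((1 - X : PowerSeries R) ^ m)).transpose * lowM P (aP x m K))

lemma Ymat_apply (P : ℕ) (x : R) (m K : ℕ) (s t : Fin P) (hs : (s : ℕ) + m < P) :
    Ymat P x m K s t = Zm (aP x m K) (dP x m K) m s t := by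
  rw [Ymat, Matrix.mul_apply, Zm, ← sum_fin_le P s]
  apply Finset.sum_congr rfl
  intro r _
  rw [show lowM P (dP x m K) s r = if (r : ℕ) ≤ s then coeff ((s : ℕ) - r) (dP x m K) else 0
    from rfl, ite_mul, zero_mul]
  split_ifs with h
  · congr 1
    have := upper_pow P (aP x m K) m r t (by omega)
    rw [← this, lowM_pow, Matrix.transpose_pow]
  · rfl

/-- sum of principal minors -/
def eM {P : ℕ} (N : ℕ) (M : Matrix (Fin P) (Fin P) R) : R :=
  ∑ s ∈ Finset.univ.powersetCard N,
      (M.submatrix (Subtype.val : s → Fin P) (Subtype.val : s → Fin P)).det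

lemma eM_comm {P : ℕ} (N : ℕ) (A B : Matrix (Fin P) (Fin P) R) :
    eM N (A * B) = eM N (B * A) := by
  unfold eM
  rw [← Matrix.coeff_det_one_add_X_smul_eq_sum_minors, ← Matrix.coeff_det_one_add_X_smul_eq_sum_minors]
  congr 1
  rw [Matrix.map_mul, Matrix.map_mul, ← Matrix.smul_mul, Matrix.det_one_add_mul_comm,
    Matrix.mul_smul]

lemma eM_dvd {P : ℕ} (N : ℕ) (c : R) (A B : Matrix (Fin P) (Fin P) R)
    (h : ∀ i j, c ∣ A i j - B i j) : c ∣ eM N A - eM N B := by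
  unfold eM
  rw [← Finset.sum_sub_distrib]
  apply Finset.dvd_sum
  intro S _
  apply det_dvd
  intro i j
  exact h _ _

lemma eM_Xdiag {P : ℕ} (N : ℕ) (x : R) (M : Matrix (Fin P) (Fin P) R) :
    eM N (Xdiag P x * M) = ∑ s ∈ (Finset.univ : Finset (Fin P)).powersetCard N, x ^ (∑ i ∈ s, (i : ℕ)) *
      (M.submatrix (Subtype.val : s → Fin P) (Subtype.val : s → Fin P)).det := by
  unfold eM
  apply Finset.sum_congr rfl
  intro S _
  have := Matrix.det_mul_column (fun i : S => x ^ ((i : Fin P) : ℕ))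
    (M.submatrix (Subtype.val : S → Fin P) (Subtype.val : S → Fin P))
  rw [← Finset.sum_coe_sort S (fun i => (i : ℕ)), ← Finset.prod_pow_eq_pow_sum, ← this]
  congr 1
  ext i j
  simp [Xdiag, Matrix.diagonal_mul]

lemma eM_conj (P N : ℕ) (x : R) (m K : ℕ) :
    x ^ (K + 1) ∣ eM N (Xdiag P x * (lowM P (geo 1 ^ m) *
      (lowM P ((1 - X : PowerSeries R) ^ m)).transpose)) - eM N (Xdiag P x * Ymat P x m K) := by
  have ha : lowM P (aP x m K) * lowM P (dP x m K) = 1 := by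
    rw [← lowM_mul, mul_comm, dP_mul_aP, lowM_one]
  have hd : lowM P (dP x m K) * lowM P (aP x m K) = 1 := by
    rw [← lowM_mul, dP_mul_aP, lowM_one]
  set B := (lowM P ((1 - X : PowerSeries R) ^ m)).transpose with hB
  have hYB : lowM P (aP x m K) * Ymat P x m K * lowM P (dP x m K) = B := by
    unfold Ymat
    rw [← mul_assoc (lowM P (aP x m K)), ha, one_mul, mul_assoc, ha, mul_one]
  have h1 : eM N (Xdiag P x * (lowM P (geo 1 ^ m) * B)) =
      eM N (lowM P (geo (x ^ (K + 1)) ^ m) * (Xdiag P x * Ymat P x m K)) := by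
    conv_lhs => rw [← hYB]
    rw [show Xdiag P x * (lowM P (geo 1 ^ m) * (lowM P (aP x m K) * Ymat P x m K *
      lowM P (dP x m K))) = (Xdiag P x * lowM P (geo 1 ^ m) * lowM P (aP x m K)) * Ymat P x m K *
      lowM P (dP x m K) by simp only [mul_assoc], eM_comm, Xdiag_A]
    congr 1
    simp only [← mul_assoc]
    rw [hd, one_mul]
  rw [h1]
  apply eM_dvd
  intro i j
  set W := Xdiag P x * Ymat P x m K
  have : (lowM P (geo (x ^ (K + 1)) ^ m) * W) i j - W i j =
      ((lowM P (geo (x ^ (K + 1)) ^ m) - 1) * W) i j := by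
    rw [sub_mul, one_mul, Matrix.sub_apply]
  rw [this, Matrix.mul_apply]
  apply Finset.dvd_sum
  intro r _
  apply Dvd.dvd.mul_right
  have h2 : (lowM P (geo (x ^ (K + 1)) ^ m) - 1) i r =
     if (r : ℕ) ≤ i then coeff ((i : ℕ) - r) (geo (x ^ (K + 1)) ^ m - 1) else 0 := by
    rw [← lowM_one]
    simp only [lowM, Matrix.sub_apply, Matrix.of_apply, map_sub]
    split_ifs <;> simp
  rw [h2]
  split_ifs
  · apply geo_pow_cong
  · simp

/-- coefficients and partial sums of `dP` -/
lemma dP_aux (x : R) (M : ℕ) (f : PowerSeries R) (v : R) (k : ℕ) (hf : ∀ j, x ^ j ∣ coeff j f)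
    (hv : x ^ (M + 1) ∣ (∑ i ∈ Finset.range (M + 1), coeff i f) - v) :
    (∀ j, x ^ j ∣ coeff j (f * (1 - PowerSeries.C (x ^ (k + 1)) * X))) ∧
    x ^ (M + 1) ∣ (∑ i ∈ Finset.range (M + 1),
      coeff i (f * (1 - PowerSeries.C (x ^ (k + 1)) * X))) - v * (1 - x ^ (k + 1)) := by
  have hc : f * (1 - PowerSeries.C (x ^ (k + 1)) * X) = f - PowerSeries.C (x ^ (k + 1)) * (X * f) := by
    ring
  rw [hc]
  constructor
  · intro j
    rw [map_sub, coeff_C_mul]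
    apply dvd_sub (hf j)
    cases j with
    | zero => simp
    | succ j =>
      rw [coeff_succ_X_mul, add_comm j 1, pow_add]
      apply mul_dvd_mul _ (hf j)
      exact pow_dvd_pow _ (by omega)
  · simp only [map_sub, coeff_C_mul, Finset.sum_sub_distrib, ← Finset.mul_sum]
    rw [Finset.sum_range_succ' (fun i => coeff i (X * f))]
    simp only [coeff_succ_X_mul, coeff_zero_X_mul, add_zero]
    have h1 : x ^ (M + 1) ∣ x ^ (k + 1) * coeff M f := by
      rw [add_comm M, pow_add]
      exact mul_dvd_mul (pow_dvd_pow _ (by omega)) (hf M)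
    have h2 : x ^ (M + 1) ∣ (1 - x ^ (k + 1)) * ((∑ i ∈ Finset.range (M + 1), coeff i f) - v) :=
      hv.mul_left _
    convert h1.add h2 using 1
    rw [Finset.sum_range_succ]
    ring

lemma dP_props (x : R) (M m K : ℕ) :
    (∀ j, x ^ j ∣ coeff j (dP x m K)) ∧
    x ^ (M + 1) ∣ (∑ i ∈ Finset.range (M + 1), coeff i (dP x m K)) -
      (∏ k ∈ Finset.range K, (1 - x ^ (k + 1))) ^ m := by
  induction K with
  | zero =>
    constructor
    · intro j
      simp only [dP, Finset.range_zero, Finset.prod_empty, coeff_one]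
      split_ifs with h
      · simp [h]
      · simp
    · simp [dP, coeff_one]
  | succ K ih =>
    rw [dP, Finset.prod_range_succ, Finset.prod_range_succ, mul_pow]
    have key : ∀ m' : ℕ,
      (∀ j, x ^ j ∣ coeff j (dP x m K * (1 - PowerSeries.C (x ^ (K + 1)) * X) ^ m')) ∧
      x ^ (M + 1) ∣ (∑ i ∈ Finset.range (M + 1),
        coeff i (dP x m K * (1 - PowerSeries.C (x ^ (K + 1)) * X) ^ m')) -
        (∏ k ∈ Finset.range K, (1 - x ^ (k + 1))) ^ m * (1 - x ^ (K + 1)) ^ m' := by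
      intro m'
      induction m' with
      | zero => simpa using ih
      | succ m' ih' =>
        have := dP_aux x M _ _ K ih'.1 ih'.2
        simpa only [pow_succ, mul_assoc] using this
    exact key m

lemma strictMono_bound (n k : ℕ) (hnk : n ≤ k) (f : Fin (n + k) → ℕ) (hf : StrictMono f)
    (hs : ∑ i, f i ≤ (n + k).choose 2 + n) :
    (∀ i : Fin (n + k), (i : ℕ) < n → f i = i) ∧ ∀ i, f i ≤ i + n := by
  have hle := fin_strictMono_le f hf
  have hg : ∑ i, (f i - (i : ℕ)) ≤ n := by
    have h1 : ∑ i, (f i - (i : ℕ)) + ∑ i : Fin (n + k), (i : ℕ) = ∑ i, f i := by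
      rw [← Finset.sum_add_distrib]
      exact Finset.sum_congr rfl (fun i _ => Nat.sub_add_cancel (hle i))
    rw [Fin.sum_univ_eq_sum_range (fun i => i), Finset.sum_range_id, ← Nat.choose_two_right] at h1
    omega
  have hmono : ∀ i j : Fin (n + k), i ≤ j → f i - (i : ℕ) ≤ f j - (j : ℕ) := by
    intro i j hij
    have h2 : StrictMono (fun l : Fin (n + k - i) => f ⟨i + l, by omega⟩ - f i) := by
      intro a b hab
      have h3 : f ⟨i + a, by omega⟩ < f ⟨i + b, by omega⟩ := hf (by simpa using hab)
      have h4 : f i ≤ f ⟨i + a, by omega⟩ := hf.monotone (by simp [Fin.le_def])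
      simp only
      omega
    have h3 : (j : ℕ) - i ≤ f ⟨i + (j - i), by omega⟩ - f i :=
      fin_strictMono_le _ h2 ⟨j - i, by omega⟩
    have h4 : f ⟨i + (j - i), by omega⟩ = f j := by
      congr 1
      ext
      simp
      omega
    rw [h4] at h3
    have := hle i
    have := hf.monotone hij
    have : (i : ℕ) ≤ j := hij
    omega
  constructor
  · intro i hi
    by_contra hne
    have h1 : 1 ≤ f i - (i : ℕ) := by have := hle i; omega
    have h2 : ∑ j ∈ Finset.Ici i, 1 ≤ ∑ j, (f j - (j : ℕ)) := by
      refine le_trans (Finset.sum_le_sum (fun j hj => ?_)) (Finset.sum_le_univ_sum_of_nonneg (fun _ => Nat.zero_le _))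
      exact h1.trans (hmono i j (Finset.mem_Ici.1 hj))
    rw [Finset.sum_const, smul_eq_mul, mul_one, Fin.card_Ici] at h2
    omega
  · intro i
    have h1 : f i - (i : ℕ) ≤ ∑ j, (f j - (j : ℕ)) :=
      Finset.single_le_sum (f := fun j => f j - (j : ℕ)) (fun _ _ => Nat.zero_le _) (Finset.mem_univ i)
    omega

theorem eM_main (P n k : ℕ) (x : R) (m : ℕ) (hnk : n ≤ k) (hP : n + k + n + m ≤ P) :
    x ^ ((n + k).choose 2 + n + 1) ∣
      eM (n + k) (Xdiag P x * (lowM P (geo 1 ^ m) *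
        (lowM P ((1 - X : PowerSeries R) ^ m)).transpose)) -
      (∑ s ∈ (Finset.univ : Finset (Fin P)).powersetCard (n + k), x ^ (∑ i ∈ s, (i : ℕ))) *
        ((∏ l ∈ Finset.range ((n + k).choose 2 + n), (1 - x ^ (l + 1))) ^ m) ^ m := by
  set K := (n + k).choose 2 + n with hK
  have h1 := eM_conj P (n + k) x m K
  suffices h : x ^ (K + 1) ∣ eM (n + k) (Xdiag P x * Ymat P x m K) -
    (∑ s ∈ (Finset.univ : Finset (Fin P)).powersetCard (n + k), x ^ (∑ i ∈ s, (i : ℕ))) *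
        ((∏ l ∈ Finset.range K, (1 - x ^ (l + 1))) ^ m) ^ m by
    have := h1.add h
    rwa [sub_add_sub_cancel] at this
  rw [eM_Xdiag, Finset.sum_mul, ← Finset.sum_sub_distrib]
  apply Finset.dvd_sum
  intro S hS
  rw [Finset.mem_powersetCard] at hS
  rw [← mul_sub]
  let f : Fin (n + k) → ℕ := fun i => S.orderEmbOfFin hS.2 i
  have hf : StrictMono f := fun i j hij => (S.orderEmbOfFin hS.2).strictMono hij
  have hsum : ∑ i, f i = ∑ i ∈ S, (i : ℕ) := by
    conv_rhs => rw [← Finset.map_orderEmbOfFin_univ S hS.2, Finset.sum_map]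
    rfl
  have hsge : (n + k).choose 2 ≤ ∑ i ∈ S, (i : ℕ) := by
    rw [← hsum, Nat.choose_two_right, ← Finset.sum_range_id, ← Fin.sum_univ_eq_sum_range (fun i => i)]
    exact Finset.sum_le_sum (fun i _ => fin_strictMono_le f hf i)
  rcases Nat.lt_or_ge K (∑ i ∈ S, (i : ℕ)) with hlt | hge
  · exact Dvd.dvd.mul_right (pow_dvd_pow _ hlt) _
  · rw [hK, add_assoc, pow_add]
    apply mul_dvd_mul (pow_dvd_pow _ hsge)
    obtain ⟨hfn, hfb⟩ := strictMono_bound n k hnk f hf (by omega)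
    have hd := dP_props x n m K
    have e1 : ((Ymat P x m K).submatrix (Subtype.val : S → Fin P) (Subtype.val : S → Fin P)).det =
        (Matrix.of fun s t => Zm (aP x m K) (dP x m K) m (f s) (f t)).det := by
      rw [← Matrix.det_submatrix_equiv_self (S.orderIsoOfFin hS.2).toEquiv]
      congr 1
      ext i j
      simp only [Matrix.submatrix_apply, Matrix.of_apply]
      rw [Ymat_apply]
      · rfl
      · have := hfb i
        show f i + m < P
        omega
    rw [e1]
    have h2 := minor_Zm x (aP x m K) (dP x m K) (dP_mul_aP x m K) hd.1 (coeff_zero_dP x m K) m n k f hf hfn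
    have h3 := DT_pow x _ (aP x m K) (dP x m K) (dP_mul_aP x m K) (coeff_zero_dP x m K)
      (coeff_zero_aP x m K) hd.1 n hd.2 m
    have := h2.add h3
    rwa [sub_add_sub_cancel] at this
end coreB


section cauchy

lemma det_cauchy (n : ℕ) (x : Fin n → ℂ) (z : ℂ) (hz : z ≠ 0) (h : ∀ i j, x i - x j + z ≠ 0) :
    (Matrix.of fun i j => z / (x i - x j + z)).det =
      ∏ i, ∏ j ∈ Finset.Ioi i, (x i - x j) ^ 2 / ((x i - x j) ^ 2 - z ^ 2) := by
  induction n with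
  | zero => simp
  | succ n ih =>
    set M : Matrix (Fin (n + 1)) (Fin (n + 1)) ℂ := Matrix.of fun i j => z / (x i - x j + z) with hM
    have hM00 : M 0 0 = 1 := by simp [hM, hz]
    let c : Fin (n + 1) → ℂ := fun i => if i = 0 then 0 else M i 0
    let B : Matrix (Fin (n + 1)) (Fin (n + 1)) ℂ := Matrix.of fun i j => M i j - c i * M 0 j
    have h1 : M.det = B.det := by
      apply Matrix.det_eq_of_forall_row_eq_smul_add_const c 0 (by simp [c])
      intro i j
      simp [B, c]
    have h2 : B.det = (B.submatrix Fin.succ Fin.succ).det := by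
      rw [Matrix.det_succ_column_zero, Fin.sum_univ_succ, Finset.sum_eq_zero]
      · simp [B, c, hM00]
      · intro i _
        simp [B, c, hM00]
    let u : Fin n → ℂ := fun i => (x i.succ - x 0) / (x i.succ - x 0 + z)
    let v : Fin n → ℂ := fun i => (x 0 - x i.succ) / (x 0 - x i.succ + z)
    have h3 : B.submatrix Fin.succ Fin.succ = Matrix.of fun i j => u i * (Matrix.of fun i j =>
        v j * (Matrix.of fun i j : Fin n => z / (x i.succ - x j.succ + z)) i j) i j := by
      ext i j
      have e1 := h i.succ j.succ
      have e2 := h i.succ 0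
      have e3 := h 0 j.succ
      simp [B, c, u, v, hM]
      field_simp
      ring
    rw [h1, h2, h3, Matrix.det_mul_column, Matrix.det_mul_row, ih _ (fun i j => h _ _),
      Fin.prod_univ_succ, Fin.prod_Ioi_zero, ← mul_assoc, ← Finset.prod_mul_distrib]
    congr 1
    · apply Finset.prod_congr rfl
      intro i _
      have e2 := h i.succ 0
      have e3 := h 0 i.succ
      have e4 : (x 0 - x i.succ) ^ 2 - z ^ 2 ≠ 0 := by
        have : (x 0 - x i.succ) ^ 2 - z ^ 2 = -((x i.succ - x 0 + z) * (x 0 - x i.succ + z)) := by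
          ring
        rw [this]
        exact neg_ne_zero.2 (mul_ne_zero e2 e3)
      simp only [u, v]
      field_simp
      ring
    · apply Finset.prod_congr rfl
      intro i _
      rw [Fin.prod_Ioi_succ]

def alph (s : ℕ) (z : ℂ) : ℂ := (∏ i ∈ Finset.range s, (z + i)) / s.factorial

def pp (s : ℕ) (z : ℂ) : ℂ := ∏ i ∈ Finset.range s, (1 + z / (i + 1))

lemma alph_zero (z : ℂ) : alph 0 z = 1 := by simp [alph]

lemma alph_succ (s : ℕ) (z : ℂ) : alph (s + 1) z = z * pp s z / (s + 1) := by
  induction s with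
  | zero => simp [alph, pp]
  | succ s ih =>
    have h : alph (s + 1 + 1) z = alph (s + 1) z * (z + (s + 1)) / (s + 2) := by
      unfold alph
      rw [Finset.prod_range_succ, Nat.factorial_succ (s + 1)]
      push_cast
      have : (s : ℂ) + 2 ≠ 0 := by norm_cast
      have : (s : ℂ) + 1 + 1 ≠ 0 := by norm_cast
      have : ((s + 1).factorial : ℂ) ≠ 0 := by exact_mod_cast Nat.factorial_ne_zero _
      field_simp
      ring
    rw [h, ih, pp, pp, Finset.prod_range_succ]
    push_cast
    have : (s : ℂ) + 2 ≠ 0 := by norm_cast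
    have : (s : ℂ) + 1 + 1 ≠ 0 := by norm_cast
    have : (s : ℂ) + 1 ≠ 0 := by norm_cast
    field_simp
    ring

lemma alph_rec (s : ℕ) (z : ℂ) : alph (s + 1) (z + 1) - alph s (z + 1) = alph (s + 1) z := by
  unfold alph
  rw [Finset.prod_range_succ, Finset.prod_range_succ' _ s, Nat.factorial_succ]
  have : ∀ i : ℕ, z + ((i + 1 : ℕ) : ℂ) = z + 1 + i := by intro i; push_cast; ring
  simp only [this]
  push_cast
  have : (s : ℂ) + 1 ≠ 0 := by norm_cast
  have : (s.factorial : ℂ) ≠ 0 := by exact_mod_cast Nat.factorial_ne_zero _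
  field_simp
  ring

def KV (z : ℂ) (r t : ℕ) : ℂ := if r ≤ t then alph (t - r) (-z) else 0

def Kz (z : ℂ) (s t : ℕ) : ℂ := ∑ r ∈ Finset.range (s + 1), alph (s - r) z * KV z r t

lemma Kz_formula (z : ℂ) (s t : ℕ) : ((s : ℂ) - t + z) * Kz z s t = z * pp s z * pp t (-z) := by
  induction s generalizing t with
  | zero =>
    cases t with
    | zero => simp [Kz, KV, alph, pp]
    | succ t =>
      simp only [Kz, zero_add, Finset.range_one, Finset.sum_singleton, KV, Nat.sub_zero, alph_zero,
        Nat.zero_le, if_true, alph_succ]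
      simp only [pp, Finset.prod_range_succ, Finset.prod_range_zero]
      push_cast
      have : (t : ℂ) + 1 ≠ 0 := by norm_cast
      field_simp
      ring
  | succ s ih =>
    cases t with
    | zero =>
      have : Kz z (s + 1) 0 = alph (s + 1) z := by
        rw [Kz, Finset.sum_range_succ', Finset.sum_eq_zero]
        · simp [KV, alph_zero]
        · intro r _
          simp [KV]
      rw [this, alph_succ]
      simp only [pp, Finset.prod_range_succ, Finset.prod_range_zero]
      push_cast
      have : (s : ℂ) + 1 ≠ 0 := by norm_cast
      field_simp
      ring
    | succ t =>
      have h : Kz z (s + 1) (t + 1) = Kz z s t + alph (s + 1) z * alph (t + 1) (-z) := by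
        rw [Kz, Finset.sum_range_succ']
        simp [KV, Kz]
      rw [h, mul_add]
      have h2 := ih t
      have : ((s + 1 : ℕ) : ℂ) - ((t + 1 : ℕ) : ℂ) + z = (s : ℂ) - t + z := by push_cast; ring
      rw [this, h2, alph_succ, alph_succ]
      have e1 : pp (s + 1) z = pp s z * (1 + z / (s + 1)) := by rw [pp, Finset.prod_range_succ, pp]
      have e2 : pp (t + 1) (-z) = pp t (-z) * (1 + -z / (t + 1)) := by
        rw [pp, Finset.prod_range_succ, pp]
      rw [e1, e2]
      have : (s : ℂ) + 1 ≠ 0 := by norm_cast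
      have : (t : ℂ) + 1 ≠ 0 := by norm_cast
      field_simp
      ring

lemma pp_mul_pp (s : ℕ) (z : ℂ) :
    pp s z * pp s (-z) = ∏ b ∈ Finset.range s, (1 - z ^ 2 / ((s : ℂ) - b) ^ 2) := by
  unfold pp
  rw [← Finset.prod_mul_distrib, ← Finset.prod_range_reflect]
  apply Finset.prod_congr rfl
  intro i hi
  rw [Finset.mem_range] at hi
  have : ((s - 1 - i : ℕ) : ℂ) + 1 = s - i := by
    have : s - 1 - i + 1 = s - i := by omega
    rw [← Nat.cast_sub hi.le, ← this]
    push_cast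
    ring
  rw [this]
  have : (s : ℂ) - i ≠ 0 := by
    rw [sub_ne_zero]
    exact_mod_cast hi.ne'
  field_simp
  ring

/-- the hook weight -/
def wz (z : ℂ) (S : Finset ℕ) : ℂ :=
  ∏ a ∈ S, ∏ b ∈ (Finset.range a).filter (· ∉ S), (1 - z ^ 2 / ((a : ℂ) - b) ^ 2)

lemma det_Kz_generic (N : ℕ) (f : Fin N ↪o ℕ) (z : ℂ) (hz : ∀ k : ℤ, z ≠ k) :
    (Matrix.of fun i j => Kz z (f i) (f j)).det = wz z (Finset.univ.map f.toEmbedding) := by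
  have hz0 : z ≠ 0 := by simpa using hz 0
  have hne : ∀ i j, ((f i : ℕ) : ℂ) - (f j : ℕ) + z ≠ 0 := by
    intro i j h
    apply hz ((f j : ℤ) - f i)
    push_cast
    linear_combination h
  have h1 : (Matrix.of fun i j => Kz z (f i) (f j)) = Matrix.of fun i j => pp (f i) z *
      (Matrix.of fun i j => pp (f j) (-z) *
        (Matrix.of fun i j => z / (((f i : ℕ) : ℂ) - (f j : ℕ) + z)) i j) i j := by
    ext i j
    have h2 := Kz_formula z (f i) (f j)
    have h3 := hne i j
    simp only [Matrix.of_apply]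
    field_simp
    linear_combination h2
  rw [h1, Matrix.det_mul_column, Matrix.det_mul_row, det_cauchy _ (fun i => ((f i : ℕ) : ℂ)) z hz0 hne,
    ← mul_assoc, ← Finset.prod_mul_distrib]
  simp only [pp_mul_pp]
  rw [Finset.prod_sigma' Finset.univ (fun i => Finset.Ioi i)]
  have hsw : ∏ p ∈ (Finset.univ : Finset (Fin N)).sigma (fun i => Finset.Ioi i),
      (((f p.1 : ℕ) : ℂ) - (f p.2 : ℕ)) ^ 2 / ((((f p.1 : ℕ) : ℂ) - (f p.2 : ℕ)) ^ 2 - z ^ 2) =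
      ∏ j, ∏ i ∈ Finset.Iio j,
      (((f i : ℕ) : ℂ) - (f j : ℕ)) ^ 2 / ((((f i : ℕ) : ℂ) - (f j : ℕ)) ^ 2 - z ^ 2) := by
    rw [Finset.prod_sigma' Finset.univ (fun i => Finset.Iio i)]
    apply Finset.prod_bij' (fun p _ => ⟨p.2, p.1⟩) (fun p _ => ⟨p.2, p.1⟩) <;> simp
  rw [hsw, ← Finset.prod_mul_distrib, wz, Finset.prod_map]
  apply Finset.prod_congr rfl
  intro j _
  rw [← Finset.prod_filter_mul_prod_filter_not (Finset.range (f j))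
    (fun b => b ∉ Finset.univ.map f.toEmbedding), mul_assoc]
  have : (Finset.range (f j)).filter (fun b => ¬ b ∉ Finset.univ.map f.toEmbedding) =
      (Finset.Iio j).map f.toEmbedding := by
    ext b
    simp only [Finset.mem_filter, Finset.mem_range, Finset.mem_map, not_not, Finset.mem_univ,
      true_and, Finset.mem_Iio]
    constructor
    · rintro ⟨hb, i, rfl⟩
      exact ⟨i, by simpa using hb, rfl⟩
    · rintro ⟨i, hi, rfl⟩
      exact ⟨by simpa using hi, i, rfl⟩
  rw [this, Finset.prod_map, ← Finset.prod_mul_distrib]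
  rw [Finset.prod_eq_one (s := Finset.Iio j), mul_one]
  · rfl
  intro i hi
  have hij : f i < f j := by simpa using hi
  have e0 : ((f j : ℕ) : ℂ) - (f i : ℕ) ≠ 0 := by
    rw [sub_ne_zero]
    exact_mod_cast hij.ne'
  have e1 : (((f i : ℕ) : ℂ) - (f j : ℕ)) ^ 2 - z ^ 2 ≠ 0 := by
    have : (((f i : ℕ) : ℂ) - (f j : ℕ)) ^ 2 - z ^ 2 =
      -((((f i : ℕ) : ℂ) - (f j : ℕ) + z) * (((f j : ℕ) : ℂ) - (f i : ℕ) + z)) := by ring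
    rw [this]
    exact neg_ne_zero.2 (mul_ne_zero (hne i j) (hne j i))
  simp only [RelEmbedding.coe_toEmbedding]
  field_simp
  ring

lemma continuous_alph (s : ℕ) : Continuous (alph s) := by
  unfold alph
  fun_prop

lemma det_Kz (N : ℕ) (f : Fin N ↪o ℕ) (z : ℂ) :
    (Matrix.of fun i j => Kz z (f i) (f j)).det = wz z (Finset.univ.map f.toEmbedding) := by
  have hd : Dense (Set.range (Int.cast : ℤ → ℂ))ᶜ :=
    (Set.countable_range _).dense_compl ℝ
  have h1 : Continuous fun z => (Matrix.of fun i j => Kz z (f i) (f j)).det := by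
    apply Continuous.matrix_det
    apply continuous_matrix
    intro i j
    simp only [Matrix.of_apply, Kz]
    apply continuous_finsetSum
    intro r _
    apply (continuous_alph _).mul
    unfold KV
    split_ifs
    · exact (continuous_alph _).comp continuous_neg
    · exact continuous_const
  have h2 : Continuous fun z => wz z (Finset.univ.map f.toEmbedding) := by
    unfold wz
    fun_prop
  have := Continuous.ext_on hd h1 h2 (fun z hz => det_Kz_generic N f z (fun k hk => hz ⟨k, hk.symm⟩))
  exact congrFun this z

lemma alph_series_succ (z : ℂ) : (1 - X) * PowerSeries.mk (fun s => alph s (z + 1)) =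
    PowerSeries.mk (fun s => alph s z) := by
  ext s
  rw [sub_mul, one_mul, map_sub]
  cases s with
  | zero => simp [alph_zero]
  | succ s => rw [coeff_succ_X_mul]; simp [alph_rec]

lemma alph_zero_right : PowerSeries.mk (fun s => alph s 0) = 1 := by
  ext s
  rw [coeff_mk, coeff_one]
  cases s with
  | zero => simp [alph_zero]
  | succ s => simp [alph_succ]

lemma alph_nat (m : ℕ) : PowerSeries.mk (fun s => alph s m) = geo 1 ^ m := by
  induction m with
  | zero => simp [alph_zero_right]
  | succ m ih =>
    have := alph_series_succ m
    have h2 := geo_mul (1 : ℂ)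
    rw [map_one, one_mul] at h2
    rw [pow_succ, ← ih, ← this, mul_right_comm, h2, one_mul]
    push_cast
    rfl

lemma alph_neg_nat (m : ℕ) : PowerSeries.mk (fun s => alph s (-(m : ℂ))) = (1 - X) ^ m := by
  induction m with
  | zero => simp [alph_zero_right]
  | succ m ih =>
    have := alph_series_succ (-((m : ℂ) + 1))
    rw [show -((m : ℂ) + 1) + 1 = -m by ring, ih] at this
    rw [pow_succ']
    push_cast
    exact this.symm

/-- minors of the product matrix, over `ℂ` -/
lemma minor_lowM (P m : ℕ) (S : Finset (Fin P)) :
    ((lowM P (geo (1 : ℂ) ^ m) * (lowM P ((1 - X : PowerSeries ℂ) ^ m)).transpose).submatrix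
      (Subtype.val : S → Fin P) (Subtype.val : S → Fin P)).det =
      wz m (S.map Fin.valEmbedding) := by
  let f : Fin S.card ↪o ℕ := (S.orderEmbOfFin rfl).trans (Fin.valOrderEmb P)
  have hf : Finset.univ.map f.toEmbedding = S.map Fin.valEmbedding := by
    conv_rhs => rw [← Finset.map_orderEmbOfFin_univ S rfl]
    rw [Finset.map_map]
    rfl
  rw [← hf, ← det_Kz, ← Matrix.det_submatrix_equiv_self (S.orderIsoOfFin rfl).toEquiv]
  congr 1
  have hV : (lowM P ((1 - X : PowerSeries ℂ) ^ m)).transpose = Matrix.of fun s t : Fin P => KV m s t := by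
    ext s t
    simp only [lowM, Matrix.transpose_apply, Matrix.of_apply, KV, ← alph_neg_nat, coeff_mk]
  ext i j
  rw [hV, ← alph_nat]
  simp only [Matrix.submatrix_apply]
  rw [lowM_mul_apply]
  simp only [coeff_mk]
  rfl

end cauchy


section partD

def GG (z : ℂ) (P N : ℕ) : Polynomial ℂ :=
  ∑ S ∈ (Finset.range P).powersetCard N,
    Polynomial.C (wz z S) * Polynomial.X ^ (∑ i ∈ S, i - N.choose 2)

def Phi (n : ℕ) : Polynomial ℂ := ∏ l ∈ Finset.range n, (1 - Polynomial.X ^ (l + 1))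

lemma Phi_cong (n K : ℕ) (h : n ≤ K) : Polynomial.X ^ (n + 1) ∣ Phi K - Phi n := by
  induction K, h using Nat.le_induction with
  | base => simp
  | succ K hK ih =>
    have : Phi (K + 1) - Phi n = (Phi K - Phi n) - Phi K * Polynomial.X ^ (K + 1) := by
      rw [Phi, Finset.prod_range_succ, ← Phi]; ring
    rw [this]
    exact dvd_sub ih ((pow_dvd_pow _ (by omega)).mul_left _)

lemma sum_fin_powerset {β : Type*} [AddCommMonoid β] (P N : ℕ) (g : Finset ℕ → β) :
    ∑ S ∈ (Finset.univ : Finset (Fin P)).powersetCard N, g (S.map Fin.valEmbedding) =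
    ∑ S ∈ (Finset.range P).powersetCard N, g S := by
  have : Finset.range P = (Finset.univ : Finset (Fin P)).map Fin.valEmbedding := by
    ext i
    simp only [Finset.mem_range, Finset.mem_map, Finset.mem_univ, true_and, Fin.valEmbedding_apply]
    exact ⟨fun h => ⟨⟨i, h⟩, rfl⟩, fun ⟨j, hj⟩ => hj ▸ j.2⟩
  rw [this, Finset.powersetCard_map, Finset.sum_map]
  rfl

lemma sum_ge_choose (N : ℕ) (S : Finset ℕ) (h : S.card = N) : N.choose 2 ≤ ∑ i ∈ S, i := by
  let f : Fin N → ℕ := fun i => S.orderEmbOfFin h i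
  have hf : StrictMono f := fun i j hij => (S.orderEmbOfFin h).strictMono hij
  have hsum : ∑ i, f i = ∑ i ∈ S, i := by
    conv_rhs => rw [← Finset.map_orderEmbOfFin_univ S h, Finset.sum_map]
    rfl
  rw [← hsum, Nat.choose_two_right, ← Finset.sum_range_id, ← Fin.sum_univ_eq_sum_range (fun i => i)]
  exact Finset.sum_le_sum (fun i _ => fin_strictMono_le f hf i)

lemma GG_mul (z : ℂ) (P N : ℕ) : Polynomial.X ^ (N.choose 2) * GG z P N =
    ∑ S ∈ (Finset.range P).powersetCard N, Polynomial.X ^ (∑ i ∈ S, i) * Polynomial.C (wz z S) := by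
  rw [GG, Finset.mul_sum]
  apply Finset.sum_congr rfl
  intro S hS
  rw [Finset.mem_powersetCard] at hS
  have := sum_ge_choose N S hS.2
  rw [mul_left_comm, ← pow_add, Nat.add_sub_cancel' this, mul_comm]

lemma lowM_map {R R' : Type*} [CommRing R] [CommRing R'] (φ : R →+* R') (P : ℕ) (f : PowerSeries R) :
    lowM P (PowerSeries.map φ f) = (lowM P f).map φ := by
  ext s t
  simp only [lowM, Matrix.of_apply, Matrix.map_apply, coeff_map]
  split_ifs <;> simp

lemma geo_map {R R' : Type*} [CommRing R] [CommRing R'] (φ : R →+* R') (c : R) :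
    PowerSeries.map φ (geo c) = geo (φ c) := by
  ext s
  simp [geo]

lemma wz_zero (S : Finset ℕ) : wz 0 S = 1 := by
  simp [wz]

lemma eM_eq_GG (P N m : ℕ) :
    eM N (Xdiag P (Polynomial.X : Polynomial ℂ) * (lowM P (geo 1 ^ m) *
        (lowM P ((1 - X : PowerSeries (Polynomial ℂ)) ^ m)).transpose)) =
      Polynomial.X ^ (N.choose 2) * GG m P N := by
  rw [GG_mul, eM_Xdiag, ← sum_fin_powerset P N]
  apply Finset.sum_congr rfl
  intro S _
  rw [← minor_lowM, Finset.sum_map]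
  congr 1
  have h1 : lowM P (geo (1 : Polynomial ℂ) ^ m) = (lowM P (geo (1 : ℂ) ^ m)).map Polynomial.C := by
    rw [← lowM_map, map_pow, geo_map, map_one]
  have h2 : lowM P ((1 - X : PowerSeries (Polynomial ℂ)) ^ m) =
      (lowM P ((1 - X : PowerSeries ℂ) ^ m)).map Polynomial.C := by
    rw [← lowM_map, map_pow, map_sub, map_one, map_X]
  rw [h1, h2, RingHom.map_det, ← Matrix.transpose_map, ← Matrix.map_mul]
  rfl

lemma GG_cong (P n k m : ℕ) (hnk : n ≤ k) (hP : n + k + n + m ≤ P) :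
    Polynomial.X ^ (n + 1) ∣ GG m P (n + k) - GG 0 P (n + k) * Phi n ^ (m * m) := by
  have h := eM_main P n k (Polynomial.X : Polynomial ℂ) m hnk hP
  rw [eM_eq_GG] at h
  have h0 : ∑ s ∈ (Finset.univ : Finset (Fin P)).powersetCard (n + k),
      (Polynomial.X : Polynomial ℂ) ^ (∑ i ∈ s, (i : ℕ)) =
      Polynomial.X ^ ((n + k).choose 2) * GG 0 P (n + k) := by
    rw [GG_mul, ← sum_fin_powerset P (n + k)]
    apply Finset.sum_congr rfl
    intro S _
    rw [Finset.sum_map, wz_zero]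
    simp
  rw [h0, mul_assoc, ← mul_sub, add_assoc, pow_add] at h
  have h2 := (mul_dvd_mul_iff_left (pow_ne_zero _ Polynomial.X_ne_zero)).1 h
  rw [← pow_mul, ← Phi] at h2
  have h3 := (Phi_cong n ((n + k).choose 2 + n) (by omega)).trans (sub_dvd_pow_sub_pow _ _ (m * m))
  have h4 := h2.add (h3.mul_left (GG 0 P (n + k)))
  convert h4 using 1
  ring

lemma wz_one (N : ℕ) (S : Finset ℕ) (hS : S.card = N) : wz 1 S = if S = Finset.range N then 1 else 0 := by
  split_ifs with h
  · subst h
    rw [wz]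
    apply Finset.prod_eq_one
    intro a ha
    apply Finset.prod_eq_one
    intro b hb
    simp only [Finset.mem_filter, Finset.mem_range] at ha hb
    omega
  · have : ∃ a, a ∉ S ∧ a + 1 ∈ S := by
      by_contra hcon
      push Not at hcon
      apply h
      have hdown : ∀ a ∈ S, ∀ b ≤ a, b ∈ S := by
        intro a ha b hb
        induction a, hb using Nat.le_induction with
        | base => exact ha
        | succ a hba ih =>
          apply ih
          by_contra h'
          exact hcon a h' ha
      apply Finset.eq_of_subset_of_card_le
      · intro a ha
        rw [Finset.mem_range]
        have : Finset.range (a + 1) ⊆ S := by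
          intro b hb
          rw [Finset.mem_range] at hb
          exact hdown a ha b (by omega)
        have := Finset.card_le_card this
        rw [Finset.card_range] at this
        omega
      · simp [hS]
    obtain ⟨a, ha, ha'⟩ := this
    rw [wz]
    apply Finset.prod_eq_zero ha'
    apply Finset.prod_eq_zero (i := a)
    · simp [ha]
    · simp

lemma GG_one (P N : ℕ) (h : N ≤ P) : GG 1 P N = 1 := by
  rw [GG, Finset.sum_eq_single (Finset.range N)]
  · rw [wz_one N _ (by simp), if_pos rfl, Finset.sum_range_id, ← Nat.choose_two_right]
    simp
  · intro S hS hne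
    rw [Finset.mem_powersetCard] at hS
    rw [wz_one N S hS.2, if_neg hne]
    simp
  · intro h'
    exfalso
    apply h'
    simp [Finset.mem_powersetCard, h]

lemma GG_zero_cong (P n k : ℕ) (hnk : n ≤ k) (hP : n + k + n + 1 ≤ P) :
    Polynomial.X ^ (n + 1) ∣ 1 - GG 0 P (n + k) * Phi n := by
  have := GG_cong P n k 1 hnk hP
  rw [Nat.cast_one, GG_one _ _ (by omega)] at this
  simpa using this

lemma GG_main (P n k m : ℕ) (hm : 1 ≤ m) (hnk : n ≤ k) (hP : n + k + n + m ≤ P) :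
    Polynomial.X ^ (n + 1) ∣ GG m P (n + k) - Phi n ^ (m * m - 1) := by
  have h1 := GG_cong P n k m hnk hP
  have h2 := GG_zero_cong P n k hnk (by omega)
  obtain ⟨e, he⟩ : ∃ e, m * m = e + 1 := ⟨m * m - 1, by have : 1 ≤ m * m := Nat.mul_le_mul hm hm
                                                        omega⟩
  rw [he] at h1 ⊢
  have := h1.sub (h2.mul_right (Phi n ^ e))
  convert this using 1
  rw [Nat.add_sub_cancel]
  ring

end partD


section partE

def bead (N : ℕ) (μ : YoungDiagram) (i : Fin N) : ℕ := μ.rowLen i + (N - 1 - i)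

def beadSet (N : ℕ) (μ : YoungDiagram) : Finset ℕ := Finset.univ.image (bead N μ)

lemma sc_colLen {μ : YoungDiagram} (h : μ.transpose = μ) (i : ℕ) : μ.colLen i = μ.rowLen i := by
  rw [← YoungDiagram.rowLen_transpose, h]

lemma bead_anti (N : ℕ) (μ : YoungDiagram) : StrictAnti (bead N μ) := by
  intro i j hij
  have h1 := μ.rowLen_anti i j (le_of_lt hij)
  have h2 : (i : ℕ) < j := hij
  have := j.2
  unfold bead
  omega

lemma bead_lt {N : ℕ} {μ : YoungDiagram} (hN : μ.rowLen 0 ≤ N) (i : Fin N) :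
    bead N μ i < 2 * N := by
  have h1 := μ.rowLen_anti 0 i (Nat.zero_le _)
  have := i.2
  unfold bead
  omega

lemma rowLen_eq_zero {N : ℕ} {μ : YoungDiagram} (h : μ.transpose = μ) (hN : μ.rowLen 0 ≤ N) (i : ℕ)
    (hi : N ≤ i) : μ.rowLen i = 0 := by
  by_contra hne
  have : (i, 0) ∈ μ := YoungDiagram.mem_iff_lt_rowLen.2 (by omega)
  have := YoungDiagram.mem_iff_lt_colLen.1 this
  rw [sc_colLen h] at this
  omega

lemma mem_iff_bead {N : ℕ} {μ : YoungDiagram} (h : μ.transpose = μ) (i j : Fin N) :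
    ((i : ℕ), (j : ℕ)) ∈ μ ↔ 2 * N ≤ bead N μ i + bead N μ j := by
  have h1 := YoungDiagram.mem_iff_lt_rowLen (μ := μ) (i := i) (j := j)
  have h2 := YoungDiagram.mem_iff_lt_colLen (μ := μ) (i := i) (j := j)
  rw [sc_colLen h] at h2
  have := i.2
  have := j.2
  unfold bead
  constructor
  · intro hm
    have := h1.1 hm
    have := h2.1 hm
    omega
  · intro hm
    by_contra hn
    rw [h1] at hn
    rw [h1] at h2
    have : ¬ ((i : ℕ) < μ.rowLen j) := fun h' => hn (h2.2 h')
    omega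

lemma bead_add_ne {N : ℕ} {μ : YoungDiagram} (h : μ.transpose = μ) (i j : Fin N) :
    bead N μ i + bead N μ j + 1 ≠ 2 * N := by
  have h1 := YoungDiagram.mem_iff_lt_rowLen (μ := μ) (i := i) (j := j)
  have h2 := YoungDiagram.mem_iff_lt_colLen (μ := μ) (i := i) (j := j)
  rw [sc_colLen h] at h2
  have := i.2
  have := j.2
  unfold bead
  by_cases hm : ((i : ℕ), (j : ℕ)) ∈ μ
  · have := h1.1 hm
    have := h2.1 hm
    omega
  · have h3 := hm
    have h4 := hm
    rw [h1] at h3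
    rw [h2] at h4
    omega

lemma hookLen_eq {N : ℕ} {μ : YoungDiagram} (h : μ.transpose = μ) (i j : Fin N)
    (hm : ((i : ℕ), (j : ℕ)) ∈ μ) :
    hookLen μ (i, j) + 2 * N = bead N μ i + bead N μ j + 1 := by
  have h1 := YoungDiagram.mem_iff_lt_rowLen.1 hm
  have h2 := YoungDiagram.mem_iff_lt_colLen.1 hm
  rw [sc_colLen h] at h2
  have := i.2
  have := j.2
  unfold bead hookLen
  simp only
  rw [sc_colLen h]
  omega

/-- the admissible symmetric bead sets -/
def SymB (N : ℕ) (S : Finset ℕ) : Prop :=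
  S ⊆ Finset.range (2 * N) ∧ ∀ v < 2 * N, v ∈ S ↔ 2 * N - 1 - v ∉ S

lemma card_beadSet (N : ℕ) (μ : YoungDiagram) : (beadSet N μ).card = N := by
  rw [beadSet, Finset.card_image_of_injective _ (bead_anti N μ).injective]
  simp

lemma sym_of_card {N : ℕ} {S : Finset ℕ} (hS : S ⊆ Finset.range (2 * N)) (hc : S.card = N)
    (h : ∀ a ∈ S, ∀ b ∈ S, a + b + 1 ≠ 2 * N) : SymB N S := by
  refine ⟨hS, ?_⟩
  let T := S.image (fun v => 2 * N - 1 - v)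
  have hT : T.card = N := by
    rw [Finset.card_image_of_injOn, hc]
    intro a ha b hb hab
    have := Finset.mem_range.1 (hS ha)
    have := Finset.mem_range.1 (hS hb)
    simp only at hab
    omega
  have hd : Disjoint S T := by
    rw [Finset.disjoint_left]
    intro a ha hb0
    obtain ⟨b, hb, rfl⟩ := Finset.mem_image.1 hb0
    have := Finset.mem_range.1 (hS hb)
    exact h _ ha _ hb (by omega)
  have hu : S ∪ T = Finset.range (2 * N) := by
    apply Finset.eq_of_subset_of_card_le
    · apply Finset.union_subset hS
      intro a ha
      obtain ⟨b, hb, rfl⟩ := Finset.mem_image.1 ha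
      have := Finset.mem_range.1 (hS hb)
      rw [Finset.mem_range]
      omega
    · rw [Finset.card_union_of_disjoint hd, hT, hc, Finset.card_range]
      omega
  intro v hv
  constructor
  · intro hvS hv'
    exact h _ hvS _ hv' (by omega)
  · intro hv'
    have : v ∈ S ∪ T := by rw [hu]; simpa using hv
    rcases Finset.mem_union.1 this with h1 | h1
    · exact h1
    · obtain ⟨b, hb, rfl⟩ := Finset.mem_image.1 h1
      have := Finset.mem_range.1 (hS hb)
      exact absurd (show 2 * N - 1 - (2 * N - 1 - b) ∈ S by
        rwa [show 2 * N - 1 - (2 * N - 1 - b) = b by omega]) hv'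

lemma sym_beadSet {N : ℕ} {μ : YoungDiagram} (h : μ.transpose = μ) (hN : μ.rowLen 0 ≤ N) :
    SymB N (beadSet N μ) := by
  apply sym_of_card
  · intro a ha
    obtain ⟨i, _, rfl⟩ := Finset.mem_image.1 ha
    exact Finset.mem_range.2 (bead_lt hN i)
  · exact card_beadSet N μ
  · intro a ha b hb
    obtain ⟨i, _, rfl⟩ := Finset.mem_image.1 ha
    obtain ⟨j, _, rfl⟩ := Finset.mem_image.1 hb
    exact bead_add_ne h i j

lemma sym_card {N : ℕ} {S : Finset ℕ} (h : SymB N S) : S.card = N := by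
  have h1 : (Finset.range (2 * N) \ S).card = S.card := by
    apply Finset.card_bij' (fun v _ => 2 * N - 1 - v) (fun v _ => 2 * N - 1 - v)
    · intro v hv
      rw [Finset.mem_sdiff, Finset.mem_range] at hv
      by_contra hc
      exact hv.2 ((h.2 v hv.1).2 hc)
    · intro v hv
      have := Finset.mem_range.1 (h.1 hv)
      rw [Finset.mem_sdiff, Finset.mem_range]
      exact ⟨by omega, (h.2 v this).1 hv⟩
    · intro v hv
      rw [Finset.mem_sdiff, Finset.mem_range] at hv
      omega
    · intro v hv
      have := Finset.mem_range.1 (h.1 hv)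
      omega
  have h2 := Finset.card_sdiff_add_card_eq_card h.1
  rw [Finset.card_range] at h2
  omega

lemma beadSet_inj {N : ℕ} {μ ν : YoungDiagram} (h : μ.transpose = μ) (hN : μ.rowLen 0 ≤ N)
    (h' : ν.transpose = ν) (hN' : ν.rowLen 0 ≤ N) (he : beadSet N μ = beadSet N ν) : μ = ν := by
  have hb : bead N μ = bead N ν := by
    rw [← StrictAnti.range_inj (bead_anti N μ) (bead_anti N ν)]
    have := congrArg (fun s : Finset ℕ => (s : Set ℕ)) he
    simpa [beadSet] using this
  ext ⟨i, j⟩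
  rw [YoungDiagram.mem_cells, YoungDiagram.mem_cells]
  rw [YoungDiagram.mem_iff_lt_rowLen, YoungDiagram.mem_iff_lt_rowLen]
  rcases Nat.lt_or_ge i N with hi | hi
  · have := congrFun hb ⟨i, hi⟩
    simp only [bead] at this
    rw [show μ.rowLen i = ν.rowLen i by omega]
  · rw [rowLen_eq_zero h hN i hi, rowLen_eq_zero h' hN' i hi]

lemma beadSet_surj {N : ℕ} {S : Finset ℕ} (hS : SymB N S) :
    ∃ μ : YoungDiagram, μ.transpose = μ ∧ μ.rowLen 0 ≤ N ∧ beadSet N μ = S := by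
  have hc := sym_card hS
  let A : Fin N → ℕ := fun i => S.orderEmbOfFin hc i.rev
  have hA : StrictAnti A := fun i j hij => (S.orderEmbOfFin hc).strictMono (Fin.rev_lt_rev.2 hij)
  have hAS : ∀ i, A i ∈ S := fun i => S.orderEmbOfFin_mem hc _
  have hAim : Finset.univ.image A = S := by
    apply Finset.eq_of_subset_of_card_le
    · intro a ha
      obtain ⟨i, _, rfl⟩ := Finset.mem_image.1 ha
      exact hAS i
    · rw [Finset.card_image_of_injective _ hA.injective, hc]
      simp
  let p : ℕ × ℕ → Prop := fun c => ∃ (h1 : c.1 < N) (h2 : c.2 < N), 2 * N ≤ A ⟨c.1, h1⟩ + A ⟨c.2, h2⟩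
  classical
  let μ : YoungDiagram :=
    { cells := (Finset.range N ×ˢ Finset.range N).filter p
      isLowerSet := by
        rintro ⟨i, j⟩ ⟨i', j'⟩ hle hm
        simp only [Finset.coe_filter, Finset.mem_product, Finset.mem_range, Set.mem_ofPred_eq, p] at hm ⊢
        obtain ⟨hi, hj⟩ := Prod.mk_le_mk.1 hle
        obtain ⟨⟨h1, h2⟩, _, _, h3⟩ := hm
        refine ⟨⟨by omega, by omega⟩, by omega, by omega, ?_⟩
        have e1 : A ⟨i, h1⟩ ≤ A ⟨i', by omega⟩ := hA.antitone (by simpa [Fin.le_def] using hi)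
        have e2 : A ⟨j, h2⟩ ≤ A ⟨j', by omega⟩ := hA.antitone (by simpa [Fin.le_def] using hj)
        omega }
  have hmem : ∀ i j : ℕ, (i, j) ∈ μ ↔ p (i, j) := by
    intro i j
    rw [← YoungDiagram.mem_cells]
    simp only [μ, Finset.mem_filter, Finset.mem_product, Finset.mem_range]
    constructor
    · exact fun h => h.2
    · intro h
      obtain ⟨h1, h2, _⟩ := id h
      exact ⟨⟨h1, h2⟩, h⟩
  have hmem' : ∀ i j : Fin N, ((i : ℕ), (j : ℕ)) ∈ μ ↔ 2 * N ≤ A i + A j := by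
    intro i j
    rw [hmem]
    exact ⟨fun ⟨_, _, h⟩ => h, fun h => ⟨i.2, j.2, h⟩⟩
  have hrow : ∀ i : Fin N, μ.rowLen i + (N - 1 - i) = A i := by
    intro i
    have e1 : μ.rowLen i = (Finset.univ.filter (fun j : Fin N => 2 * N ≤ A i + A j)).card := by
      rw [← Finset.card_range (μ.rowLen i)]
      symm
      apply Finset.card_bij (fun (j : Fin N) _ => (j : ℕ))
      · intro j hj
        rw [Finset.mem_filter] at hj
        rw [Finset.mem_range, ← YoungDiagram.mem_iff_lt_rowLen, hmem']
        exact hj.2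
      · intro a _ b _ hab
        exact Fin.ext hab
      · intro j hj
        rw [Finset.mem_range, ← YoungDiagram.mem_iff_lt_rowLen] at hj
        obtain ⟨_, h2, h3⟩ := (hmem _ _).1 hj
        exact ⟨⟨j, h2⟩, by simpa using h3, rfl⟩
    have e2 : (Finset.univ.filter (fun j : Fin N => 2 * N ≤ A i + A j)).card =
        ((Finset.range (A i)).filter (· ∉ S)).card := by
      apply Finset.card_bij (fun (j : Fin N) _ => 2 * N - 1 - A j)
      · intro j hj
        rw [Finset.mem_filter] at hj
        have hlt := Finset.mem_range.1 (hS.1 (hAS j))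
        have hlt2 := Finset.mem_range.1 (hS.1 (hAS i))
        rw [Finset.mem_filter, Finset.mem_range]
        exact ⟨by omega, (hS.2 _ hlt).1 (hAS j)⟩
      · intro a _ b _ hab
        have hlt := Finset.mem_range.1 (hS.1 (hAS a))
        have hlt2 := Finset.mem_range.1 (hS.1 (hAS b))
        exact hA.injective (by omega)
      · intro b hb
        rw [Finset.mem_filter, Finset.mem_range] at hb
        have hlt2 := Finset.mem_range.1 (hS.1 (hAS i))
        have h1 : 2 * N - 1 - b ∈ S := by
          rw [hS.2 _ (by omega), show 2 * N - 1 - (2 * N - 1 - b) = b by omega]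
          exact hb.2
        rw [← hAim] at h1
        obtain ⟨j, _, hj⟩ := Finset.mem_image.1 h1
        exact ⟨j, by simp; omega, by omega⟩
    have e3 : ((Finset.range (A i)).filter (· ∈ S)).card = N - 1 - i := by
      have : (Finset.range (A i)).filter (· ∈ S) = (Finset.Ioi i).image A := by
        ext a
        simp only [Finset.mem_filter, Finset.mem_range, Finset.mem_image, Finset.mem_Ioi]
        constructor
        · rintro ⟨h1, h2⟩
          rw [← hAim] at h2
          obtain ⟨j, _, rfl⟩ := Finset.mem_image.1 h2
          exact ⟨j, hA.lt_iff_gt.1 h1, rfl⟩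
        · rintro ⟨j, hj, rfl⟩
          exact ⟨hA hj, hAS j⟩
      rw [this, Finset.card_image_of_injective _ hA.injective, Fin.card_Ioi]
    have e4 := Finset.card_filter_add_card_filter_not (s := Finset.range (A i)) (fun a => a ∈ S)
    rw [Finset.card_range] at e4
    omega
  refine ⟨μ, ?_, ?_, ?_⟩
  · ext ⟨i, j⟩
    rw [YoungDiagram.mem_cells, YoungDiagram.mem_cells, YoungDiagram.mem_transpose]
    simp only [Prod.swap]
    rw [hmem, hmem]
    simp only [p]
    constructor
    · rintro ⟨h1, h2, h3⟩
      exact ⟨h2, h1, by omega⟩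
    · rintro ⟨h1, h2, h3⟩
      exact ⟨h2, h1, by omega⟩
  · by_contra hcon
    have : (0, N) ∈ μ := YoungDiagram.mem_iff_lt_rowLen.2 (by omega)
    obtain ⟨_, h2, _⟩ := (hmem _ _).1 this
    simp at h2
  · rw [← hAim, beadSet]
    congr 1
    ext i
    exact hrow i

end partE


section partF

lemma beadSet_mem {N : ℕ} {μ : YoungDiagram} (i : Fin N) : bead N μ i ∈ beadSet N μ :=
  Finset.mem_image_of_mem _ (Finset.mem_univ i)

lemma mem_lt {N : ℕ} {μ : YoungDiagram} (h : μ.transpose = μ) (hN : μ.rowLen 0 ≤ N) {c : ℕ × ℕ}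
    (hc : c ∈ μ) : c.1 < N ∧ c.2 < N := by
  obtain ⟨i, j⟩ := c
  have h1 := YoungDiagram.mem_iff_lt_rowLen.1 hc
  have h2 := YoungDiagram.mem_iff_lt_colLen.1 hc
  rw [sc_colLen h] at h2
  have h3 := rowLen_eq_zero h hN i
  have h4 := rowLen_eq_zero h hN j
  simp only
  omega

lemma sum_sym {N : ℕ} {S : Finset ℕ} (hS : SymB N S) :
    ∑ v ∈ S, v = ∑ u ∈ Finset.range N, u + ∑ v ∈ S.filter (N ≤ ·), (2 * (v - N) + 1) := by
  rw [← Finset.sum_filter_add_sum_filter_not S (N ≤ ·)]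
  rw [← Finset.sum_filter_add_sum_filter_not (Finset.range N) (· ∈ S)]
  have h1 : S.filter (fun v => ¬ N ≤ v) = (Finset.range N).filter (· ∈ S) := by
    ext v
    simp only [Finset.mem_filter, Finset.mem_range, not_le]
    exact and_comm
  have h2 : ∑ u ∈ (Finset.range N).filter (fun v => ¬ v ∈ S), u =
      ∑ v ∈ S.filter (N ≤ ·), (2 * N - 1 - v) := by
    apply Finset.sum_bij' (fun v _ => 2 * N - 1 - v) (fun v _ => 2 * N - 1 - v)
    · intro v hv
      rw [Finset.mem_filter, Finset.mem_range] at hv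
      rw [Finset.mem_filter]
      refine ⟨?_, by omega⟩
      by_contra hc
      exact hv.2 ((hS.2 v (by omega)).2 hc)
    · intro v hv
      rw [Finset.mem_filter] at hv
      have := Finset.mem_range.1 (hS.1 hv.1)
      rw [Finset.mem_filter, Finset.mem_range]
      exact ⟨by omega, (hS.2 v this).1 hv.1⟩
    · intro v hv
      rw [Finset.mem_filter, Finset.mem_range] at hv
      omega
    · intro v hv
      rw [Finset.mem_filter] at hv
      have := Finset.mem_range.1 (hS.1 hv.1)
      omega
    · intro v hv
      rw [Finset.mem_filter, Finset.mem_range] at hv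
      omega
  have h3 : ∑ v ∈ S.filter (N ≤ ·), v = ∑ v ∈ S.filter (N ≤ ·), (2 * N - 1 - v) +
      ∑ v ∈ S.filter (N ≤ ·), (2 * (v - N) + 1) := by
    rw [← Finset.sum_add_distrib]
    apply Finset.sum_congr rfl
    intro v hv
    rw [Finset.mem_filter] at hv
    have := Finset.mem_range.1 (hS.1 hv.1)
    omega
  rw [h1, h2, h3]
  ring

lemma card_eq_beads {N : ℕ} {μ : YoungDiagram} (h : μ.transpose = μ) (hN : μ.rowLen 0 ≤ N) :
    μ.card = ∑ v ∈ (beadSet N μ).filter (N ≤ ·), (2 * (v - N) + 1) := by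
  have h1 := sum_sym (sym_beadSet h hN)
  have h2 : ∑ v ∈ beadSet N μ, v = ∑ i : Fin N, μ.rowLen i + ∑ u ∈ Finset.range N, u := by
    rw [beadSet, Finset.sum_image (fun i _ j _ hij => (bead_anti N μ).injective hij),
      ← Finset.sum_range_reflect, ← Fin.sum_univ_eq_sum_range (fun i => N - 1 - i),
      ← Finset.sum_add_distrib]
    rfl
  have h3 : μ.card = ∑ i : Fin N, μ.rowLen i := by
    rw [Fin.sum_univ_eq_sum_range (fun i => μ.rowLen i)]
    have := Finset.card_eq_sum_card_fiberwise (s := μ.cells) (t := Finset.range N) (f := Prod.fst)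
      (by
        intro c hc
        simpa using (mem_lt h hN ((YoungDiagram.mem_cells c).1 hc)).1)
    refine this.trans ?_
    apply Finset.sum_congr rfl
    intro i _
    rw [YoungDiagram.rowLen_eq_card]
    rfl
  omega

lemma durfee_eq_beads {N : ℕ} {μ : YoungDiagram} (h : μ.transpose = μ) (hN : μ.rowLen 0 ≤ N) :
    durfee μ = ((beadSet N μ).filter (N ≤ ·)).card := by
  rw [beadSet, Finset.filter_image, Finset.card_image_of_injective _ (bead_anti N μ).injective]
  symm
  apply Finset.card_bij (fun (i : Fin N) _ => ((i : ℕ), (i : ℕ)))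
  · intro i hi
    rw [Finset.mem_filter] at hi ⊢
    rw [YoungDiagram.mem_cells, mem_iff_bead h]
    exact ⟨by omega, rfl⟩
  · intro i _ j _ hij
    exact Fin.ext (Prod.mk.inj hij).1
  · rintro ⟨i, j⟩ hc
    rw [Finset.mem_filter, YoungDiagram.mem_cells] at hc
    obtain ⟨hc, hij⟩ := hc
    simp only at hij
    subst hij
    have hi := (mem_lt h hN hc).1
    have := (mem_iff_bead h ⟨i, hi⟩ ⟨i, hi⟩).1 hc
    exact ⟨⟨i, hi⟩, by simp; omega, rfl⟩

lemma prod_cells {N : ℕ} {μ : YoungDiagram} (h : μ.transpose = μ) (hN : μ.rowLen 0 ≤ N) (t : ℕ)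
    (y z : ℂ) :
    ∏ c ∈ μ.cells.filter (fun c => t ∣ hookLen μ c),
      (y - y * z * (t : ℕ) / ((hookLen μ c : ℂ) * eps c)) =
    ∏ p ∈ (beadSet N μ ×ˢ beadSet N μ).filter
        (fun p => 2 * N ≤ p.1 + p.2 ∧ t ∣ p.1 + p.2 + 1 - 2 * N),
      (y - y * z * (t : ℕ) / (((p.1 + p.2 + 1 - 2 * N : ℕ) : ℂ) *
        if p.1 < p.2 then (-1 : ℂ) else 1)) := by
  apply Finset.prod_bij (fun c _ => (μ.rowLen c.1 + (N - 1 - c.1), μ.rowLen c.2 + (N - 1 - c.2)))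
  · rintro ⟨i, j⟩ hc
    rw [Finset.mem_filter, YoungDiagram.mem_cells] at hc
    obtain ⟨hi, hj⟩ := mem_lt h hN hc.1
    have h1 := (mem_iff_bead h ⟨i, hi⟩ ⟨j, hj⟩).1 hc.1
    have h2 := hookLen_eq h ⟨i, hi⟩ ⟨j, hj⟩ hc.1
    simp only [bead] at h1 h2
    rw [Finset.mem_filter, Finset.mem_product]
    refine ⟨⟨beadSet_mem (⟨i, hi⟩ : Fin N), beadSet_mem (⟨j, hj⟩ : Fin N)⟩, h1, ?_⟩
    simp only
    rw [← h2, Nat.add_sub_cancel]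
    exact hc.2
  · rintro ⟨i, j⟩ hc ⟨i', j'⟩ hc' he
    rw [Finset.mem_filter, YoungDiagram.mem_cells] at hc hc'
    obtain ⟨hi, hj⟩ := mem_lt h hN hc.1
    obtain ⟨hi', hj'⟩ := mem_lt h hN hc'.1
    obtain ⟨e1, e2⟩ := Prod.mk.inj he
    have e3 := (bead_anti N μ).injective (a₁ := ⟨i, hi⟩) (a₂ := ⟨i', hi'⟩) e1
    have e4 := (bead_anti N μ).injective (a₁ := ⟨j, hj⟩) (a₂ := ⟨j', hj'⟩) e2
    simp only [Fin.mk.injEq] at e3 e4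
    rw [e3, e4]
  · rintro ⟨a, b⟩ hp
    rw [Finset.mem_filter, Finset.mem_product] at hp
    obtain ⟨⟨ha, hb⟩, h1, h2⟩ := hp
    obtain ⟨i, _, rfl⟩ := Finset.mem_image.1 ha
    obtain ⟨j, _, rfl⟩ := Finset.mem_image.1 hb
    simp only at h1 h2
    have hm := (mem_iff_bead h i j).2 h1
    refine ⟨(i, j), ?_, rfl⟩
    rw [Finset.mem_filter, YoungDiagram.mem_cells]
    refine ⟨hm, ?_⟩
    rwa [← hookLen_eq h i j hm, Nat.add_sub_cancel] at h2
  · rintro ⟨i, j⟩ hc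
    rw [Finset.mem_filter, YoungDiagram.mem_cells] at hc
    obtain ⟨hi, hj⟩ := mem_lt h hN hc.1
    have h2 := hookLen_eq h ⟨i, hi⟩ ⟨j, hj⟩ hc.1
    have h3 := (bead_anti N μ).lt_iff_gt (a := ⟨i, hi⟩) (b := ⟨j, hj⟩)
    simp only [bead] at h2 h3
    simp only
    rw [← h2, Nat.add_sub_cancel]
    congr 3
    unfold eps
    simp only
    congr 1
    rw [h3]
    simp

lemma refl_eq (t L q r : ℕ) (hq : q < 2 * L) (hr : r < t) :
    2 * (t * L) - 1 - (t * q + r) = t * (2 * L - 1 - q) + (t - 1 - r) := by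
  obtain ⟨d, hd⟩ := Nat.exists_eq_add_of_lt hq
  have h1 : 2 * (t * L) = t * q + t * d + t := by
    calc 2 * (t * L) = t * (2 * L) := by ring
      _ = t * (q + d + 1) := by rw [hd]
      _ = _ := by ring
  rw [h1, show 2 * L - 1 - q = d by omega]
  omega

lemma dm (t q r : ℕ) (hr : r < t) : (t * q + r) / t = q ∧ (t * q + r) % t = r := by
  have ht : 0 < t := by omega
  constructor
  · rw [Nat.mul_add_div ht, Nat.div_eq_of_lt hr, add_zero]
  · rw [Nat.mul_add_mod, Nat.mod_eq_of_lt hr]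

lemma lt_iff_div (t L q r : ℕ) (hr : r < t) : t * q + r < 2 * (t * L) ↔ q < 2 * L := by
  constructor
  · intro h
    by_contra hc
    have : t * (2 * L) ≤ t * q := Nat.mul_le_mul_left _ (by omega)
    have : t * (2 * L) = 2 * (t * L) := by ring
    omega
  · intro h
    have : t * (q + 1) ≤ t * (2 * L) := Nat.mul_le_mul_left _ (by omega)
    have : t * (2 * L) = 2 * (t * L) := by ring
    have : t * (q + 1) = t * q + t := by ring
    omega

lemma exists_qr (t v : ℕ) (ht : 0 < t) : ∃ q r, r < t ∧ v = t * q + r :=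
  ⟨v / t, v % t, Nat.mod_lt _ ht, (Nat.div_add_mod v t).symm⟩

def Qs (t L : ℕ) (S : Finset ℕ) (ρ : ℕ) : Finset ℕ :=
  (Finset.range (2 * L)).filter (fun k => t * k + ρ ∈ S)

lemma sym_mem {t L : ℕ} {S : Finset ℕ} (hS : SymB (t * L) S) (q r : ℕ) (hq : q < 2 * L) (hr : r < t) :
    t * q + r ∈ S ↔ t * (2 * L - 1 - q) + (t - 1 - r) ∉ S := by
  rw [hS.2 _ ((lt_iff_div t L q r hr).2 hq), refl_eq t L q r hq hr]

lemma prod_T {t' L : ℕ} (ht' : 0 < t') {S : Finset ℕ} (hS : SymB (2 * t' * L) S) (y z : ℂ) :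
    ∏ p ∈ (S ×ˢ S).filter
        (fun p => 2 * (2 * t' * L) ≤ p.1 + p.2 ∧ 2 * t' ∣ p.1 + p.2 + 1 - 2 * (2 * t' * L)),
      (y - y * z * (2 * t' : ℕ) / (((p.1 + p.2 + 1 - 2 * (2 * t' * L) : ℕ) : ℂ) *
        if p.1 < p.2 then (-1 : ℂ) else 1)) =
    ∏ ρ : Fin t', ∏ k ∈ Qs (2 * t') L S ρ, ∏ k' ∈ (Finset.range k).filter (· ∉ Qs (2 * t') L S ρ),
      (y ^ 2 - y ^ 2 * z ^ 2 / ((k : ℂ) - k') ^ 2) := by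
  obtain ⟨t, ht⟩ : ∃ t, t = 2 * t' := ⟨_, rfl⟩
  rw [← ht] at hS ⊢
  set T := (S ×ˢ S).filter
        (fun p => 2 * (t * L) ≤ p.1 + p.2 ∧ t ∣ p.1 + p.2 + 1 - 2 * (t * L)) with hT
  have htpos : 0 < t := by omega
  -- description of `T`
  have hTd : ∀ p : ℕ × ℕ, p ∈ T ↔ ∃ k k' r, r < t ∧ k' < k ∧ k < 2 * L ∧ t * k + r ∈ S ∧
      t * k' + r ∉ S ∧ p = (t * k + r, t * (2 * L - 1 - k') + (t - 1 - r)) := by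
    rintro ⟨a, b⟩
    rw [hT, Finset.mem_filter, Finset.mem_product]
    constructor
    · rintro ⟨⟨ha, hb⟩, h1, h2⟩
      simp only at ha hb h1 h2
      obtain ⟨k, r, hr, rfl⟩ := exists_qr t a htpos
      obtain ⟨q, r2, hr2, rfl⟩ := exists_qr t b htpos
      have hk := (lt_iff_div t L k r hr).1 (Finset.mem_range.1 (hS.1 ha))
      have hq := (lt_iff_div t L q r2 hr2).1 (Finset.mem_range.1 (hS.1 hb))
      obtain ⟨c, hc⟩ := h2
      have hc1 : r + r2 + 1 + t * (k + q) = t * (c + 2 * L) := by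
        have : t * (k + q) = t * k + t * q := by ring
        have : t * (c + 2 * L) = t * c + 2 * (t * L) := by ring
        omega
      have hdiv : t ∣ r + r2 + 1 := by
        have : t ∣ r + r2 + 1 + t * (k + q) := by rw [hc1]; exact dvd_mul_right _ _
        exact (Nat.dvd_add_left (dvd_mul_right _ _)).1 this
      obtain ⟨e, he⟩ := hdiv
      have he1 : e = 1 := by
        have : e ≠ 0 := by rintro rfl; omega
        have : e < 2 := by
          by_contra hcon
          have : t * 2 ≤ t * e := Nat.mul_le_mul_left _ (by omega)
          omega
        omega
      rw [he1, mul_one] at he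
      have hc2 : k + q + 1 = c + 2 * L := by
        have : t * (k + q + 1) = t * (c + 2 * L) := by rw [← hc1, he]; ring
        exact Nat.eq_of_mul_eq_mul_left htpos this
      have hcpos : 0 < c := by
        rcases Nat.eq_zero_or_pos c with h0 | h0
        · subst h0
          omega
        · exact h0
      refine ⟨k, 2 * L - 1 - q, r, hr, by omega, hk, ha, ?_, ?_⟩
      · have := (sym_mem hS q r2 hq hr2).1 hb
        rwa [show t - 1 - r2 = r by omega] at this
      · rw [show 2 * L - 1 - (2 * L - 1 - q) = q by omega, show t - 1 - r = r2 by omega]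
    · rintro ⟨k, k', r, hr, hkk, hk, ha, hb, he⟩
      obtain ⟨rfl, rfl⟩ := Prod.mk.inj he
      have hsum : t * k + r + (t * (2 * L - 1 - k') + (t - 1 - r)) + 1 =
          t * (k - k') + 2 * (t * L) := by
        have h1 := refl_eq t L k' r (by omega) hr
        have h2 := (lt_iff_div t L k' r hr).2 (by omega)
        have h3 : t * k = t * k' + t * (k - k') := by rw [← mul_add]; congr 1; omega
        omega
      refine ⟨⟨ha, ?_⟩, ?_, ?_⟩
      · by_contra hcon
        exact hb ((sym_mem hS k' r (by omega) hr).2 hcon)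
      · simp only
        have : t * 1 ≤ t * (k - k') := Nat.mul_le_mul_left _ (by omega)
        omega
      · simp only
        rw [hsum, Nat.add_sub_cancel]
        exact dvd_mul_right _ _
  have hhook : ∀ k k' r, r < t → k' < k → k < 2 * L →
      t * k + r + (t * (2 * L - 1 - k') + (t - 1 - r)) + 1 - 2 * (t * L) = t * (k - k') := by
    intro k k' r hr hkk hk
    have h1 := refl_eq t L k' r (by omega) hr
    have h2 := (lt_iff_div t L k' r hr).2 (by omega)
    have h3 : t * k = t * k' + t * (k - k') := by rw [← mul_add]; congr 1; omega
    omega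
  have hne : ∀ k q r, r < t → t * k + r ≠ t * q + (t - 1 - r) := by
    intro k q r hr heq
    have h1 := (dm t k r hr).2
    rw [heq, (dm t q (t - 1 - r) (by omega)).2] at h1
    omega
  rw [← Finset.prod_filter_mul_prod_filter_not T (fun p => p.1 % t < t')]
  have hswap : ∏ p ∈ T.filter (fun p => ¬ p.1 % t < t'),
      (y - y * z * (t : ℕ) / (((p.1 + p.2 + 1 - 2 * (t * L) : ℕ) : ℂ) *
        if p.1 < p.2 then (-1 : ℂ) else 1)) =
      ∏ p ∈ T.filter (fun p => p.1 % t < t'),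
      (y - y * z * (t : ℕ) / (((p.1 + p.2 + 1 - 2 * (t * L) : ℕ) : ℂ) *
        if p.2 < p.1 then (-1 : ℂ) else 1)) := by
    have hsw : ∀ p : ℕ × ℕ, p ∈ T → p.swap ∈ T ∧ (p.swap.1 % t = t - 1 - p.1 % t) := by
      intro p hp
      constructor
      · rw [hT, Finset.mem_filter, Finset.mem_product] at hp ⊢
        simp only [Prod.fst_swap, Prod.snd_swap]
        rw [add_comm p.2 p.1]
        exact ⟨⟨hp.1.2, hp.1.1⟩, hp.2⟩
      · obtain ⟨k, k', r, hr, hkk, hk, ha, hb, rfl⟩ := (hTd p).1 hp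
        simp only [Prod.fst_swap]
        rw [(dm t _ (t - 1 - r) (by omega)).2, (dm t _ r hr).2]
    refine Finset.prod_bij' (fun p _ => p.swap) (fun p _ => p.swap) ?_ ?_ ?_ ?_ ?_
    · intro p hp
      rw [Finset.mem_filter] at hp ⊢
      have := hsw p hp.1
      have := Nat.mod_lt p.1 htpos
      exact ⟨(hsw p hp.1).1, by omega⟩
    · intro p hp
      rw [Finset.mem_filter] at hp ⊢
      have := hsw p hp.1
      have := Nat.mod_lt p.1 htpos
      exact ⟨(hsw p hp.1).1, by omega⟩
    · intro p _; simp
    · intro p _; simp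
    · intro p _
      simp only [Prod.fst_swap, Prod.snd_swap]
      rw [add_comm p.2 p.1]
  rw [hswap, ← Finset.prod_mul_distrib]
  simp only [Finset.prod_sigma']
  symm
  apply Finset.prod_bij (fun (x : Σ _ : Fin t', Σ _ : ℕ, ℕ) _ =>
    (t * x.2.1 + x.1, t * (2 * L - 1 - x.2.2) + (t - 1 - x.1)))
  · rintro ⟨ρ, k, k'⟩ hx
    simp only [Finset.mem_sigma, Finset.mem_univ, true_and, Qs, Finset.mem_filter,
      Finset.mem_range, not_and] at hx
    obtain ⟨⟨hk, hkS⟩, hkk, hk'⟩ := hx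
    have hρ := ρ.2
    rw [Finset.mem_filter, hTd]
    refine ⟨⟨k, k', ρ, by omega, hkk, hk, hkS, hk' (by omega), rfl⟩, ?_⟩
    rw [(dm t k ρ (by omega)).2]
    exact hρ
  · rintro ⟨ρ, k, k'⟩ hx ⟨ρ2, k2, k2'⟩ hx2 he
    simp only [Finset.mem_sigma, Finset.mem_univ, true_and, Qs, Finset.mem_filter,
      Finset.mem_range, not_and] at hx hx2
    have hρ := ρ.2
    have hρ2 := ρ2.2
    obtain ⟨e1, e2⟩ := Prod.mk.inj he
    simp only at e1 e2
    have a1 := dm t k ρ (by omega)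
    rw [e1] at a1
    have a2 := dm t k2 ρ2 (by omega)
    have b1 := dm t (2 * L - 1 - k') (t - 1 - ρ) (by omega)
    rw [e2] at b1
    have b2 := dm t (2 * L - 1 - k2') (t - 1 - ρ2) (by omega)
    have c1 : k = k2 := a1.1.symm.trans a2.1
    have c2 : ρ = ρ2 := Fin.ext (a1.2.symm.trans a2.2)
    have c3 : k' = k2' := by
      have := b1.1.symm.trans b2.1
      omega
    subst c1 c2 c3
    rfl
  · intro p hp
    rw [Finset.mem_filter] at hp
    obtain ⟨k, k', r, hr, hkk, hk, ha, hb, rfl⟩ := (hTd p).1 hp.1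
    have hr' := hp.2
    simp only at hr'
    rw [(dm t k r hr).2] at hr'
    refine ⟨⟨⟨r, hr'⟩, k, k'⟩, ?_, rfl⟩
    simp only [Finset.mem_sigma, Finset.mem_univ, true_and, Qs, Finset.mem_filter,
      Finset.mem_range, not_and]
    exact ⟨⟨hk, ha⟩, hkk, fun _ => hb⟩
  · rintro ⟨ρ, k, k'⟩ hx
    simp only [Finset.mem_sigma, Finset.mem_univ, true_and, Qs, Finset.mem_filter,
      Finset.mem_range, not_and] at hx
    obtain ⟨⟨hk, hkS⟩, hkk, hk'⟩ := hx
    have hρ := ρ.2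
    simp only
    rw [hhook k k' ρ (by omega) hkk hk]
    have hn := hne k (2 * L - 1 - k') ρ (by omega)
    have e0 : (k : ℂ) - k' ≠ 0 := by
      rw [sub_ne_zero]
      exact_mod_cast hkk.ne'
    have e1 : (t : ℂ) ≠ 0 := by exact_mod_cast htpos.ne'
    push_cast [Nat.cast_sub hkk.le]
    rcases Nat.lt_or_gt_of_ne hn with hlt | hgt
    · rw [if_pos hlt, if_neg (by omega)]
      field_simp
      ring
    · rw [if_neg (by omega), if_pos hgt]
      field_simp
      ring

end partF


section partG

lemma prod_half {M : Type*} [CommMonoid M] {t' L : ℕ} (ht' : 0 < t') {S : Finset ℕ}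
    (hS : SymB (2 * t' * L) S) (ψ : ℕ → M) :
    ∏ v ∈ S.filter (2 * t' * L ≤ ·), ψ v =
    ∏ ρ : Fin t', ((∏ k ∈ (Qs (2 * t') L S ρ).filter (L ≤ ·), ψ (2 * t' * k + ρ)) *
      ∏ k ∈ (Finset.range L).filter (· ∉ Qs (2 * t') L S ρ),
        ψ (2 * t' * (2 * L - 1 - k) + (2 * t' - 1 - ρ))) := by
  obtain ⟨t, ht⟩ : ∃ t, t = 2 * t' := ⟨_, rfl⟩
  rw [← ht] at hS ⊢
  have htpos : 0 < t := by omega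
  have hle : ∀ q r, r < t → (t * L ≤ t * q + r ↔ L ≤ q) := by
    intro q r hr
    constructor
    · intro h
      by_contra hc
      have : t * (q + 1) ≤ t * L := Nat.mul_le_mul_left _ (by omega)
      have : t * (q + 1) = t * q + t := by ring
      omega
    · intro h
      have : t * L ≤ t * q := Nat.mul_le_mul_left _ h
      omega
  rw [Finset.prod_mul_distrib,
    ← Finset.prod_filter_mul_prod_filter_not (S.filter (t * L ≤ ·)) (fun v => v % t < t')]
  congr 1
  · rw [Finset.prod_sigma']
    symm
    apply Finset.prod_bij (fun (x : Σ _ : Fin t', ℕ) _ => t * x.2 + x.1)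
    · rintro ⟨ρ, k⟩ hx
      simp only [Finset.mem_sigma, Finset.mem_univ, true_and, Qs, Finset.mem_filter,
        Finset.mem_range] at hx
      have hρ := ρ.2
      rw [Finset.mem_filter, Finset.mem_filter, hle _ _ (by omega)]
      refine ⟨⟨hx.1.2, hx.2⟩, ?_⟩
      rw [(dm t k ρ (by omega)).2]
      exact hρ
    · rintro ⟨ρ, k⟩ hx ⟨ρ2, k2⟩ hx2 he
      have hρ := ρ.2
      have hρ2 := ρ2.2
      simp only at he
      have a1 := dm t k ρ (by omega)
      rw [he] at a1
      have a2 := dm t k2 ρ2 (by omega)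
      have c1 : k = k2 := a1.1.symm.trans a2.1
      have c2 : ρ = ρ2 := Fin.ext (a1.2.symm.trans a2.2)
      subst c1 c2
      rfl
    · intro v hv
      obtain ⟨q, r, hr, rfl⟩ := exists_qr t v htpos
      rw [Finset.mem_filter, Finset.mem_filter, hle _ _ (by omega), (dm t q r hr).2] at hv
      have hq := (lt_iff_div t L q r hr).1 (Finset.mem_range.1 (hS.1 hv.1.1))
      refine ⟨⟨⟨r, hv.2⟩, q⟩, ?_, rfl⟩
      simp only [Finset.mem_sigma, Finset.mem_univ, true_and, Qs, Finset.mem_filter,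
        Finset.mem_range]
      exact ⟨⟨hq, hv.1.1⟩, hv.1.2⟩
    · intros; rfl
  · rw [Finset.prod_sigma']
    symm
    apply Finset.prod_bij (fun (x : Σ _ : Fin t', ℕ) _ =>
      t * (2 * L - 1 - x.2) + (t - 1 - x.1))
    · rintro ⟨ρ, k⟩ hx
      simp only [Finset.mem_sigma, Finset.mem_univ, true_and, Qs, Finset.mem_filter,
        Finset.mem_range, not_and] at hx
      have hρ := ρ.2
      rw [Finset.mem_filter, Finset.mem_filter, hle _ _ (by omega)]
      refine ⟨⟨?_, by simp only; omega⟩, ?_⟩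
      · by_contra hcon
        exact hx.2 (by omega) ((sym_mem hS k ρ (by omega) (by omega)).2 hcon)
      · rw [(dm t _ (t - 1 - ρ) (by omega)).2]
        omega
    · rintro ⟨ρ, k⟩ hx ⟨ρ2, k2⟩ hx2 he
      simp only [Finset.mem_sigma, Finset.mem_univ, true_and, Finset.mem_filter,
        Finset.mem_range] at hx hx2
      have hρ := ρ.2
      have hρ2 := ρ2.2
      simp only at he
      have a1 := dm t (2 * L - 1 - k) (t - 1 - ρ) (by omega)
      rw [he] at a1
      have a2 := dm t (2 * L - 1 - k2) (t - 1 - ρ2) (by omega)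
      have c1 : k = k2 := by
        have := a1.1.symm.trans a2.1
        omega
      have c2 : ρ = ρ2 := Fin.ext (by
        have := a1.2.symm.trans a2.2
        omega)
      subst c1 c2
      rfl
    · intro v hv
      obtain ⟨q, r, hr, rfl⟩ := exists_qr t v htpos
      rw [Finset.mem_filter, Finset.mem_filter, hle _ _ (by omega), (dm t q r hr).2] at hv
      have hq := (lt_iff_div t L q r hr).1 (Finset.mem_range.1 (hS.1 hv.1.1))
      refine ⟨⟨⟨t - 1 - r, by omega⟩, 2 * L - 1 - q⟩, ?_, ?_⟩
      · simp only [Finset.mem_sigma, Finset.mem_univ, true_and, Qs, Finset.mem_filter,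
          Finset.mem_range, not_and]
        exact ⟨by omega, fun _ => (sym_mem hS q r hq hr).1 hv.1.1⟩
      · simp only
        rw [show 2 * L - 1 - (2 * L - 1 - q) = q by omega, show t - 1 - (t - 1 - r) = r by omega]
    · intros; rfl

/-- the weight of a self-conjugate diagram -/
def Wt (t : ℕ) (y z : ℂ) (μ : YoungDiagram) : PowerSeries ℂ :=
  PowerSeries.C (R := ℂ) ((-1) ^ durfee μ *
        ∏ c ∈ μ.cells.filter (fun c => t ∣ hookLen μ c),
          (y - y * z * (t : ℕ) / ((hookLen μ c : ℂ) * eps c))) * X ^ μ.card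

/-- the exponential part of one runner -/
def runE (t L ρ : ℕ) (Q : Finset ℕ) : PowerSeries ℂ :=
  (∏ k ∈ Q.filter (L ≤ ·), (-X ^ (2 * t * (k - L) + 2 * ρ + 1))) *
    ∏ k ∈ (Finset.range L).filter (· ∉ Q), (-X ^ (2 * t * (L - 1 - k) + 2 * (t - 1 - ρ) + 1))

/-- hook part of one runner -/
def runH (y z : ℂ) (Q : Finset ℕ) : ℂ :=
  ∏ k ∈ Q, ∏ k' ∈ (Finset.range k).filter (· ∉ Q), (y ^ 2 - y ^ 2 * z ^ 2 / ((k : ℂ) - k') ^ 2)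

lemma Wt_eq {t' L : ℕ} (ht' : 0 < t') (y z : ℂ) {μ : YoungDiagram} (h : μ.transpose = μ)
    (hN : μ.rowLen 0 ≤ 2 * t' * L) :
    Wt (2 * t') y z μ = ∏ ρ : Fin t',
      (runE (2 * t') L ρ (Qs (2 * t') L (beadSet (2 * t' * L) μ) ρ) *
        PowerSeries.C (R := ℂ) (runH y z (Qs (2 * t') L (beadSet (2 * t' * L) μ) ρ))) := by
  have hS := sym_beadSet h hN
  unfold Wt
  rw [prod_cells h hN, prod_T ht' hS, map_mul, mul_right_comm, Finset.prod_mul_distrib, map_prod]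
  congr 1
  have h1 : (C (R := ℂ) ((-1) ^ durfee μ)) * X ^ μ.card =
      ∏ v ∈ (beadSet (2 * t' * L) μ).filter (2 * t' * L ≤ ·),
        (-X ^ (2 * (v - 2 * t' * L) + 1) : PowerSeries ℂ) := by
    rw [Finset.prod_neg, Finset.prod_pow_eq_pow_sum, ← card_eq_beads h hN, ← durfee_eq_beads h hN]
    simp
  rw [h1, prod_half ht' hS]
  apply Finset.prod_congr rfl
  intro ρ _
  have hρ := ρ.2
  unfold runE
  congr 1
  · apply Finset.prod_congr rfl
    intro k hk
    rw [Finset.mem_filter] at hk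
    congr 2
    obtain ⟨d, rfl⟩ := Nat.exists_eq_add_of_le hk.2
    rw [show 2 * t' * (L + d) + (ρ : ℕ) - 2 * t' * L = 2 * t' * d + ρ by
      rw [mul_add]; omega, Nat.add_sub_cancel_left]
    ring
  · apply Finset.prod_congr rfl
    intro k hk
    rw [Finset.mem_filter, Finset.mem_range] at hk
    congr 2
    obtain ⟨d, rfl⟩ := Nat.exists_eq_add_of_lt hk.1
    rw [show 2 * (k + d + 1) - 1 - k = (k + d + 1) + d by omega,
      show k + d + 1 - 1 - k = d by omega]
    rw [show 2 * t' * (k + d + 1 + d) + (2 * t' - 1 - (ρ : ℕ)) - 2 * t' * (k + d + 1) =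
      2 * t' * d + (2 * t' - 1 - ρ) by rw [mul_add _ (k + d + 1) d]; omega]
    ring

/-- the symmetric bead set built from its runners -/
def SQ (t' L : ℕ) (Q : Fin t' → Finset ℕ) : Finset ℕ :=
  (Finset.range (2 * (2 * t' * L))).filter (fun v =>
    (∃ ρ : Fin t', v % (2 * t') = ρ ∧ v / (2 * t') ∈ Q ρ) ∨
    (∃ ρ : Fin t', v % (2 * t') = 2 * t' - 1 - ρ ∧ 2 * L - 1 - v / (2 * t') ∉ Q ρ))

lemma mem_SQ_lo {t' L : ℕ} (Q : Fin t' → Finset ℕ) (ρ : Fin t') (k : ℕ)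
    (hk : k < 2 * L) : 2 * t' * k + ρ ∈ SQ t' L Q ↔ k ∈ Q ρ := by
  have hρ := ρ.2
  have h1 := dm (2 * t') k ρ (by omega)
  rw [SQ, Finset.mem_filter, Finset.mem_range, lt_iff_div _ _ _ _ (by omega), h1.1, h1.2]
  constructor
  · rintro ⟨_, ⟨σ, h, h'⟩ | ⟨σ, h, h'⟩⟩
    · rwa [Fin.ext h]
    · have := σ.2
      omega
  · intro h
    exact ⟨hk, Or.inl ⟨ρ, rfl, h⟩⟩

lemma mem_SQ_hi {t' L : ℕ} (Q : Fin t' → Finset ℕ) (ρ : Fin t') (k : ℕ)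
    (hk : k < 2 * L) : 2 * t' * (2 * L - 1 - k) + (2 * t' - 1 - ρ) ∈ SQ t' L Q ↔ k ∉ Q ρ := by
  have hρ := ρ.2
  have h1 := dm (2 * t') (2 * L - 1 - k) (2 * t' - 1 - ρ) (by omega)
  rw [SQ, Finset.mem_filter, Finset.mem_range, lt_iff_div _ _ _ _ (by omega), h1.1, h1.2,
    show 2 * L - 1 - (2 * L - 1 - k) = k by omega]
  constructor
  · rintro ⟨_, ⟨σ, h, h'⟩ | ⟨σ, h, h'⟩⟩
    · have := σ.2
      omega
    · have := σ.2
      rwa [show ρ = σ from Fin.ext (by omega)]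
  · intro h
    exact ⟨by omega, Or.inr ⟨ρ, rfl, h⟩⟩

lemma sym_SQ {t' L : ℕ} (ht' : 0 < t') (Q : Fin t' → Finset ℕ) :
    SymB (2 * t' * L) (SQ t' L Q) := by
  refine ⟨Finset.filter_subset _ _, ?_⟩
  intro v hv
  obtain ⟨q, r, hr, rfl⟩ := exists_qr (2 * t') v (by omega)
  have hq := (lt_iff_div _ L q r hr).1 hv
  rw [refl_eq _ L q r hq hr]
  by_cases hrt : r < t'
  · have h1 := mem_SQ_lo Q ⟨r, hrt⟩ q hq
    have h2 := mem_SQ_hi Q ⟨r, hrt⟩ q hq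
    simp only at h1 h2
    rw [h1, h2, not_not]
  · have h1 := mem_SQ_lo (L := L) Q ⟨2 * t' - 1 - r, by omega⟩ (2 * L - 1 - q) (by omega)
    have h2 := mem_SQ_hi (L := L) Q ⟨2 * t' - 1 - r, by omega⟩ (2 * L - 1 - q) (by omega)
    simp only at h1 h2
    rw [show 2 * L - 1 - (2 * L - 1 - q) = q by omega,
      show 2 * t' - 1 - (2 * t' - 1 - r) = r by omega] at h2
    rw [h1, h2]

lemma Qs_SQ {t' L : ℕ} (Q : Fin t' → Finset ℕ) (ρ : Fin t')
    (hQ : Q ρ ⊆ Finset.range (2 * L)) : Qs (2 * t') L (SQ t' L Q) ρ = Q ρ := by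
  ext k
  rw [Qs, Finset.mem_filter, Finset.mem_range]
  constructor
  · rintro ⟨h1, h2⟩
    exact (mem_SQ_lo Q ρ k h1).1 h2
  · intro h
    have h1 := Finset.mem_range.1 (hQ h)
    exact ⟨h1, (mem_SQ_lo Q ρ k h1).2 h⟩

lemma SQ_Qs {t' L : ℕ} (ht' : 0 < t') {S : Finset ℕ} (hS : SymB (2 * t' * L) S) :
    SQ t' L (fun ρ => Qs (2 * t') L S ρ) = S := by
  have key : ∀ v, v < 2 * (2 * t' * L) → (v ∈ SQ t' L (fun ρ => Qs (2 * t') L S ρ) ↔ v ∈ S) := by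
    intro v hv
    obtain ⟨q, r, hr, rfl⟩ := exists_qr (2 * t') v (by omega)
    have hq := (lt_iff_div _ L q r hr).1 hv
    by_cases hrt : r < t'
    · have h1 := mem_SQ_lo (fun ρ : Fin t' => Qs (2 * t') L S ρ) ⟨r, hrt⟩ q hq
      simp only at h1
      rw [h1, Qs, Finset.mem_filter, Finset.mem_range]
      exact and_iff_right hq
    · have h2 := mem_SQ_hi (L := L) (fun ρ : Fin t' => Qs (2 * t') L S ρ) ⟨2 * t' - 1 - r, by omega⟩
        (2 * L - 1 - q) (by omega)
      simp only at h2
      rw [show 2 * L - 1 - (2 * L - 1 - q) = q by omega,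
        show 2 * t' - 1 - (2 * t' - 1 - r) = r by omega] at h2
      rw [h2, sym_mem hS q r hq hr, Qs, Finset.mem_filter, Finset.mem_range]
      rw [and_iff_right (by omega)]
  ext v
  constructor
  · intro h
    exact (key v (Finset.mem_range.1 ((sym_SQ ht' _).1 h))).1 h
  · intro h
    exact (key v (Finset.mem_range.1 (hS.1 h))).2 h

/-- generating function of one runner -/
def runF (t L ρ : ℕ) (y z : ℂ) : PowerSeries ℂ :=
  ∑ Q ∈ (Finset.range (2 * L)).powerset, runE t L ρ Q * PowerSeries.C (R := ℂ) (runH y z Q)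

lemma box_sum {t' L : ℕ} (ht' : 0 < t') :
    ∃ F : Finset {μ : YoungDiagram // μ.transpose = μ},
      (∀ μ : {μ : YoungDiagram // μ.transpose = μ}, μ.1.rowLen 0 ≤ 2 * t' * L → μ ∈ F) ∧
      ∀ y z : ℂ, ∑ μ ∈ F, Wt (2 * t') y z μ.1 = ∏ ρ : Fin t', runF (2 * t') L ρ y z := by
  classical
  have hex : ∀ Q : Fin t' → Finset ℕ, ∃ μ : {μ : YoungDiagram // μ.transpose = μ},
      μ.1.rowLen 0 ≤ 2 * t' * L ∧ beadSet (2 * t' * L) μ.1 = SQ t' L Q := by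
    intro Q
    obtain ⟨μ, h1, h2, h3⟩ := beadSet_surj (sym_SQ (L := L) ht' Q)
    exact ⟨⟨μ, h1⟩, h2, h3⟩
  choose nu hnu1 hnu2 using hex
  let P := Fintype.piFinset (fun _ : Fin t' => (Finset.range (2 * L)).powerset)
  have hP : ∀ Q ∈ P, ∀ ρ, Q ρ ⊆ Finset.range (2 * L) := by
    intro Q hQ ρ
    exact Finset.mem_powerset.1 (Fintype.mem_piFinset.1 hQ ρ)
  refine ⟨P.image nu, ?_, ?_⟩
  · intro μ hμ
    have hS := sym_beadSet μ.2 hμ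
    refine Finset.mem_image.2 ⟨fun ρ => Qs (2 * t') L (beadSet (2 * t' * L) μ.1) ρ, ?_, ?_⟩
    · rw [Fintype.mem_piFinset]
      intro ρ
      exact Finset.mem_powerset.2 (Finset.filter_subset _ _)
    · apply Subtype.ext
      apply beadSet_inj (nu _).2 (hnu1 _) μ.2 hμ
      rw [hnu2, SQ_Qs ht' hS]
  · intro y z
    rw [Finset.sum_image]
    · unfold runF
      rw [Finset.prod_univ_sum]
      apply Finset.sum_congr rfl
      intro Q hQ
      rw [Wt_eq ht' y z (nu Q).2 (hnu1 Q), hnu2]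
      apply Finset.prod_congr rfl
      intro ρ _
      rw [Qs_SQ Q ρ (hP Q hQ ρ)]
    · intro Q hQ Q' hQ' he
      funext ρ
      rw [← Qs_SQ Q ρ (hP Q hQ ρ), ← Qs_SQ Q' ρ (hP Q' hQ' ρ), ← hnu2, ← hnu2, he]

lemma rowLen_le_card (μ : YoungDiagram) : μ.rowLen 0 ≤ μ.card := by
  rw [YoungDiagram.rowLen_eq_card]
  exact Finset.card_le_card (Finset.filter_subset _ _)

end partG


section partJ

def expE (t L ρ : ℕ) (Q : Finset ℕ) : ℕ :=
  ∑ k ∈ Q.filter (L ≤ ·), (2 * t * (k - L) + 2 * ρ + 1) +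
    ∑ k ∈ (Finset.range L).filter (· ∉ Q), (2 * t * (L - 1 - k) + 2 * (t - 1 - ρ) + 1)

def cntE (L : ℕ) (Q : Finset ℕ) : ℕ :=
  (Q.filter (L ≤ ·)).card + ((Finset.range L).filter (· ∉ Q)).card

lemma runE_eq (t L ρ : ℕ) (Q : Finset ℕ) :
    runE t L ρ Q = (-1) ^ cntE L Q * X ^ expE t L ρ Q := by
  unfold runE cntE expE
  rw [Finset.prod_neg, Finset.prod_neg, Finset.prod_pow_eq_pow_sum, Finset.prod_pow_eq_pow_sum,
    pow_add, pow_add]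
  ring

lemma filt_eq (L : ℕ) (Q : Finset ℕ) :
    Q.filter (fun k => ¬ L ≤ k) = (Finset.range L).filter (· ∈ Q) := by
  ext v
  simp only [Finset.mem_filter, Finset.mem_range, not_le]
  exact and_comm

lemma expE_int (t L ρ : ℕ) (hρ : ρ < t) (Q : Finset ℕ) :
    (expE t L ρ Q : ℤ) = ∑ k ∈ Q, (2 * t * ((k : ℤ) - L) + 2 * ρ + 1) -
      ∑ k ∈ Finset.range L, (2 * t * ((k : ℤ) - L) + 2 * ρ + 1) := by
  rw [← Finset.sum_filter_add_sum_filter_not Q (L ≤ ·), filt_eq,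
    ← Finset.sum_filter_add_sum_filter_not (Finset.range L) (· ∈ Q)]
  unfold expE
  push_cast
  have h1 : ∑ k ∈ Q.filter (L ≤ ·), (2 * t * ((k - L : ℕ) : ℤ) + 2 * ρ + 1) =
      ∑ k ∈ Q.filter (L ≤ ·), (2 * t * ((k : ℤ) - L) + 2 * ρ + 1) := by
    apply Finset.sum_congr rfl
    intro k hk
    rw [Finset.mem_filter] at hk
    rw [Nat.cast_sub hk.2]
  have h2 : ∑ k ∈ (Finset.range L).filter (· ∉ Q),
        (2 * t * ((L - 1 - k : ℕ) : ℤ) + 2 * ((t - 1 - ρ : ℕ) : ℤ) + 1) =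
      - ∑ k ∈ (Finset.range L).filter (· ∉ Q), (2 * t * ((k : ℤ) - L) + 2 * ρ + 1) := by
    rw [← Finset.sum_neg_distrib]
    apply Finset.sum_congr rfl
    intro k hk
    rw [Finset.mem_filter, Finset.mem_range] at hk
    have e1 : ((L - 1 - k : ℕ) : ℤ) = L - 1 - k := by omega
    have e2 : ((t - 1 - ρ : ℕ) : ℤ) = t - 1 - ρ := by omega
    rw [e1, e2]
    ring
  rw [h1, h2]
  ring

lemma cntE_le_expE (t L ρ : ℕ) (Q : Finset ℕ) : cntE L Q ≤ expE t L ρ Q := by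
  unfold cntE expE
  rw [Finset.card_eq_sum_ones, Finset.card_eq_sum_ones]
  apply add_le_add
  · apply Finset.sum_le_sum
    intro k _
    omega
  · apply Finset.sum_le_sum
    intro k _
    omega

lemma cntE_split (L : ℕ) (Q : Finset ℕ) : ∃ j, Q.card = (Q.filter (L ≤ ·)).card + j ∧
    L = j + ((Finset.range L).filter (· ∉ Q)).card := by
  refine ⟨((Finset.range L).filter (· ∈ Q)).card, ?_, ?_⟩
  · rw [← filt_eq, Finset.card_filter_add_card_filter_not]
  · have := Finset.card_filter_add_card_filter_not (s := Finset.range L) (· ∈ Q)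
    rw [Finset.card_range] at this
    exact this.symm

lemma cntE_sign (L : ℕ) (Q : Finset ℕ) :
    ((-1 : PowerSeries ℂ)) ^ cntE L Q = (-1) ^ (Q.card + L) := by
  obtain ⟨j, h1, h2⟩ := cntE_split L Q
  have : Q.card + L = cntE L Q + 2 * j := by
    unfold cntE
    omega
  rw [this, pow_add, pow_mul]
  simp

lemma cntE_ge (L : ℕ) (Q : Finset ℕ) : Q.card ≤ L + cntE L Q ∧ L ≤ Q.card + cntE L Q := by
  obtain ⟨j, h1, h2⟩ := cntE_split L Q
  unfold cntE
  omega

lemma sum_range_choose (N : ℕ) : ∑ i ∈ Finset.range N, i = N.choose 2 := by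
  rw [Finset.sum_range_id, Nat.choose_two_right]

lemma expE_card (t L ρ : ℕ) (hρ : ρ < t) (Q : Finset ℕ) :
    expE t L ρ Q = expE t L ρ (Finset.range Q.card) + 2 * t * (∑ i ∈ Q, i - Q.card.choose 2) := by
  have h1 := expE_int t L ρ hρ Q
  have h2 := expE_int t L ρ hρ (Finset.range Q.card)
  have h3 := sum_ge_choose Q.card Q rfl
  zify [h3]
  rw [h1, h2, ← sum_range_choose]
  push_cast
  have : ∀ R : Finset ℕ, ∑ k ∈ R, (2 * (t : ℤ) * ((k : ℤ) - L) + 2 * ρ + 1) =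
      2 * t * ∑ k ∈ R, (k : ℤ) + R.card * (-2 * t * L + 2 * ρ + 1) := by
    intro R
    rw [Finset.mul_sum, ← nsmul_eq_mul, ← Finset.sum_const, ← Finset.sum_add_distrib]
    apply Finset.sum_congr rfl
    intro k _
    ring
  rw [this Q, this (Finset.range Q.card), Finset.card_range]
  ring

lemma pairs_card (Q : Finset ℕ) :
    ∑ k ∈ Q, ((Finset.range k).filter (· ∉ Q)).card = ∑ i ∈ Q, i - Q.card.choose 2 := by
  have key : ∑ k ∈ Q, (Q.filter (· < k)).card = Q.card.choose 2 := by
    induction Q using Finset.induction_on_max with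
    | empty => simp
    | insert a s ha ih =>
      have has : a ∉ s := fun h => lt_irrefl _ (ha a h)
      rw [Finset.sum_insert has, Finset.card_insert_of_notMem has, Nat.choose_succ_succ, ← ih,
        Nat.choose_one_right]
      congr 1
      · congr 1
        ext v
        simp only [Finset.mem_filter, Finset.mem_insert]
        constructor
        · rintro ⟨h | h, h'⟩
          · omega
          · exact h
        · intro h
          exact ⟨Or.inr h, ha v h⟩
      · apply Finset.sum_congr rfl
        intro k hk
        congr 1
        ext v
        simp only [Finset.mem_filter, Finset.mem_insert]
        constructor
        · rintro ⟨h | h, h'⟩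
          · have := ha k hk
            omega
          · exact ⟨h, h'⟩
        · rintro ⟨h, h'⟩
          exact ⟨Or.inr h, h'⟩
  have h2 : ∑ k ∈ Q, ((Finset.range k).filter (· ∉ Q)).card + ∑ k ∈ Q, (Q.filter (· < k)).card =
      ∑ i ∈ Q, i := by
    rw [← Finset.sum_add_distrib]
    apply Finset.sum_congr rfl
    intro k _
    have := Finset.card_filter_add_card_filter_not (s := Finset.range k) (· ∈ Q)
    rw [Finset.card_range] at this
    have e : Q.filter (· < k) = (Finset.range k).filter (· ∈ Q) := by
      ext v
      simp only [Finset.mem_filter, Finset.mem_range]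
      exact and_comm
    rw [e]
    omega
  omega

lemma runH_eq (y z : ℂ) (Q : Finset ℕ) :
    runH y z Q = (y ^ 2) ^ (∑ i ∈ Q, i - Q.card.choose 2) * wz z Q := by
  unfold runH wz
  rw [← pairs_card, ← Finset.prod_pow_eq_pow_sum, ← Finset.prod_mul_distrib]
  apply Finset.prod_congr rfl
  intro k _
  rw [← Finset.prod_const, ← Finset.prod_mul_distrib]
  apply Finset.prod_congr rfl
  intro k' _
  ring

/-- the variable of a runner -/
def qv (t : ℕ) (y : ℂ) : PowerSeries ℂ := PowerSeries.C (R := ℂ) (y ^ 2) * X ^ (2 * t)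

lemma runF_eq (t L ρ : ℕ) (hρ : ρ < t) (y z : ℂ) :
    runF t L ρ y z = ∑ N ∈ Finset.range (2 * L + 1),
      (-1) ^ (N + L) * X ^ expE t L ρ (Finset.range N) *
        Polynomial.aeval (qv t y) (GG z (2 * L) N) := by
  unfold runF
  rw [Finset.sum_powerset, Finset.card_range]
  apply Finset.sum_congr rfl
  intro N _
  unfold GG
  rw [map_sum, Finset.mul_sum]
  apply Finset.sum_congr rfl
  intro Q hQ
  rw [Finset.mem_powersetCard] at hQ
  rw [runE_eq, cntE_sign, expE_card t L ρ hρ, runH_eq, hQ.2]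
  simp only [map_mul, map_pow, Polynomial.aeval_X, Polynomial.aeval_C, qv]
  rw [mul_pow, pow_add (X : PowerSeries ℂ), pow_mul (X : PowerSeries ℂ) (2 * t), PowerSeries.algebraMap_apply]
  simp only [Algebra.algebraMap_self, RingHom.id_apply]
  ring

/-- the truncation homomorphism -/
abbrev trc (n : ℕ) : PowerSeries ℂ →+* PowerSeries ℂ ⧸ Ideal.span {(X : PowerSeries ℂ) ^ (n + 1)} :=
  Ideal.Quotient.mk _

lemma trc_eq {n : ℕ} {a b : PowerSeries ℂ} : trc n a = trc n b ↔ X ^ (n + 1) ∣ a - b := by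
  rw [Ideal.Quotient.eq, Ideal.mem_span_singleton]

lemma trc_zero {n k : ℕ} (h : n < k) : trc n (X ^ k) = 0 := by
  rw [Ideal.Quotient.eq_zero_iff_mem, Ideal.mem_span_singleton]
  exact pow_dvd_pow _ h

lemma trc_aeval {n t : ℕ} (ht : 0 < t) (y : ℂ) {a b : Polynomial ℂ}
    (h : Polynomial.X ^ (n + 1) ∣ a - b) :
    trc n (Polynomial.aeval (qv t y) a) = trc n (Polynomial.aeval (qv t y) b) := by
  rw [trc_eq, ← map_sub]
  obtain ⟨c, hc⟩ := h
  rw [hc, map_mul, map_pow, Polynomial.aeval_X]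
  apply Dvd.dvd.mul_right
  unfold qv
  apply pow_dvd_pow_of_dvd
  apply Dvd.dvd.mul_left
  exact dvd_pow_self _ (by omega)

/-- the theta sum -/
def theta (t L ρ : ℕ) : PowerSeries ℂ :=
  ∑ N ∈ Finset.range (2 * L + 1), (-1) ^ (N + L) * X ^ expE t L ρ (Finset.range N)

lemma expE_big (t L ρ n N : ℕ) (h : ¬ (N ≤ L + n ∧ L ≤ N + n)) :
    n < expE t L ρ (Finset.range N) := by
  have h1 := cntE_le_expE t L ρ (Finset.range N)
  have h2 := cntE_ge L (Finset.range N)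
  rw [Finset.card_range] at h2
  omega

lemma runF_main (t L ρ : ℕ) (hρ : ρ < t) (y : ℂ) (m n : ℕ) (hm : 1 ≤ m) (hL : 3 * n + m + 1 ≤ L) :
    trc n (runF t L ρ y m) =
      trc n (theta t L ρ * Polynomial.aeval (qv t y) (Phi n) ^ (m * m - 1)) := by
  rw [runF_eq t L ρ hρ, theta, Finset.sum_mul, map_sum, map_sum]
  apply Finset.sum_congr rfl
  intro N _
  by_cases h : N ≤ L + n ∧ L ≤ N + n
  · rw [map_mul, map_mul _ _ (_ ^ (m * m - 1)), ← map_pow (Polynomial.aeval (qv t y))]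
    congr 1
    apply trc_aeval (by omega)
    have := GG_main (2 * L) n (N - n) m hm (by omega) (by omega)
    rwa [show n + (N - n) = N by omega] at this
  · have h0 := trc_zero (expE_big t L ρ n N h)
    simp only [map_mul, h0, mul_zero, zero_mul]

lemma runF_zero (t L ρ : ℕ) (hρ : ρ < t) (n : ℕ) (hL : 3 * n + 1 ≤ L) :
    trc n (runF t L ρ 1 0 * Polynomial.aeval (qv t 1) (Phi n)) = trc n (theta t L ρ) := by
  rw [runF_eq t L ρ hρ, theta, Finset.sum_mul, map_sum, map_sum]
  apply Finset.sum_congr rfl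
  intro N _
  by_cases h : N ≤ L + n ∧ L ≤ N + n
  · rw [mul_assoc, ← map_mul (Polynomial.aeval (qv t 1)), map_mul]
    have := GG_zero_cong (2 * L) n (N - n) (by omega) (by omega)
    rw [show n + (N - n) = N by omega] at this
    rw [← trc_aeval (by omega) 1 this, map_one, map_one, mul_one]
  · have h0 := trc_zero (expE_big t L ρ n N h)
    simp only [map_mul, h0, mul_zero, zero_mul]

lemma runF_prod (t L ρ : ℕ) : runF t L ρ 1 0 =
    ∏ k ∈ Finset.range L, ((1 - X ^ (2 * t * k + 2 * ρ + 1)) *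
      (1 - X ^ (2 * t * k + 2 * (t - 1 - ρ) + 1))) := by
  have h1 := Finset.prod_add
    (fun k => if L ≤ k then (-X ^ (2 * t * (k - L) + 2 * ρ + 1) : PowerSeries ℂ) else 1)
    (fun k => if k < L then (-X ^ (2 * t * (L - 1 - k) + 2 * (t - 1 - ρ) + 1) : PowerSeries ℂ) else 1)
    (Finset.range (2 * L))
  have h2 : runF t L ρ 1 0 = ∑ Q ∈ (Finset.range (2 * L)).powerset,
      (∏ k ∈ Q, if L ≤ k then (-X ^ (2 * t * (k - L) + 2 * ρ + 1) : PowerSeries ℂ) else 1) *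
      ∏ k ∈ Finset.range (2 * L) \ Q,
        if k < L then (-X ^ (2 * t * (L - 1 - k) + 2 * (t - 1 - ρ) + 1) : PowerSeries ℂ) else 1 := by
    unfold runF
    apply Finset.sum_congr rfl
    intro Q _
    rw [← Finset.prod_filter, ← Finset.prod_filter, runH_eq, wz_zero]
    simp only [one_pow, mul_one, map_one, runE]
    congr 2
    ext k
    simp only [Finset.mem_filter, Finset.mem_range, Finset.mem_sdiff]
    constructor
    · rintro ⟨a, b⟩
      exact ⟨⟨by omega, b⟩, a⟩
    · rintro ⟨⟨_, b⟩, a⟩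
      exact ⟨a, b⟩
  rw [h2, ← h1, two_mul, Finset.prod_range_add, Finset.prod_mul_distrib, mul_comm]
  congr 1
  · apply Finset.prod_congr rfl
    intro k _
    rw [if_pos (by omega), if_neg (by omega), Nat.add_sub_cancel_left]
    ring
  · rw [← Finset.prod_range_reflect (fun k => 1 - X ^ (2 * t * k + 2 * (t - 1 - ρ) + 1))]
    apply Finset.prod_congr rfl
    intro k hk
    rw [Finset.mem_range] at hk
    rw [if_neg (by omega), if_pos hk]
    ring

/-- odd product -/
def Odd' (V : ℕ) : PowerSeries ℂ := ∏ v ∈ Finset.range V, (1 - X ^ (2 * v + 1))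

lemma prod_mul_range {M : Type*} [CommMonoid M] (f : ℕ → M) (t L : ℕ) :
    ∏ v ∈ Finset.range (t * L), f v =
      ∏ k ∈ Finset.range L, ∏ r ∈ Finset.range t, f (t * k + r) := by
  induction L with
  | zero => simp
  | succ L ih => rw [mul_add, mul_one, Finset.prod_range_add, Finset.prod_range_succ, ih]

lemma runF_odd (t' L : ℕ) : ∏ ρ : Fin t', runF (2 * t') L ρ 1 0 = Odd' (2 * t' * L) := by
  rw [Fin.prod_univ_eq_prod_range (fun ρ => runF (2 * t') L ρ 1 0)]
  simp only [runF_prod]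
  rw [Finset.prod_comm, Odd', prod_mul_range]
  apply Finset.prod_congr rfl
  intro k _
  rw [show Finset.range (2 * t') = Finset.range (t' + t') by rw [two_mul], Finset.prod_range_add,
    Finset.prod_mul_distrib]
  congr 1
  · apply Finset.prod_congr rfl
    intro r _
    congr 2
    ring
  · rw [← Finset.prod_range_reflect]
    apply Finset.prod_congr rfl
    intro r hr
    rw [Finset.mem_range] at hr
    congr 2
    rw [show 2 * t' - 1 - (t' - 1 - r) = t' + r by omega]
    ring

/-- distinct parts product -/
def Dis (V : ℕ) : PowerSeries ℂ := ∏ k ∈ Finset.range V, (1 + X ^ (k + 1))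

/-- Euler product -/
def PhiS (V : ℕ) : PowerSeries ℂ := ∏ k ∈ Finset.range V, (1 - X ^ (k + 1))

lemma euler_fin (V : ℕ) : Odd' V * Dis V * PhiS V = PhiS (2 * V) := by
  induction V with
  | zero => simp [Odd', Dis, PhiS]
  | succ V ih =>
    rw [show 2 * (V + 1) = 2 * V + 1 + 1 by ring]
    unfold Odd' Dis PhiS at *
    rw [Finset.prod_range_succ _ V, Finset.prod_range_succ _ V, Finset.prod_range_succ _ V,
      Finset.prod_range_succ _ (2 * V + 1), Finset.prod_range_succ _ (2 * V), ← ih]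
    ring

lemma trc_prod_range (n K : ℕ) (hK : n ≤ K) (f : ℕ → PowerSeries ℂ)
    (hf : ∀ k, n ≤ k → trc n (f k) = 1) :
    trc n (∏ k ∈ Finset.range K, f k) = trc n (∏ k ∈ Finset.range n, f k) := by
  obtain ⟨d, rfl⟩ := Nat.exists_eq_add_of_le hK
  rw [Finset.prod_range_add, map_mul, map_prod (trc n) (fun x => f (n + x)),
    Finset.prod_eq_one (fun x _ => hf (n + x) (by omega)), mul_one]

lemma isUnit_prod (f : ℕ → PowerSeries ℂ) (hf : ∀ k, constantCoeff (f k) = 1) (s : Finset ℕ) :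
    IsUnit (∏ k ∈ s, f k) := by
  rw [PowerSeries.isUnit_iff_constantCoeff, map_prod, Finset.prod_eq_one (fun k _ => hf k)]
  exact isUnit_one

lemma euler_cong (n V : ℕ) (h : n ≤ V) : trc n (Odd' V) * trc n (Dis n) = 1 := by
  have hP : ∀ W, n ≤ W → trc n (PhiS W) = trc n (PhiS n) := by
    intro W hW
    apply trc_prod_range n W hW
    intro k hk
    rw [map_sub, trc_zero (by omega), sub_zero, map_one]
  have hD : trc n (Dis V) = trc n (Dis n) := by
    apply trc_prod_range n V h
    intro k hk
    rw [map_add, trc_zero (by omega), add_zero, map_one]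
  have h1 := congrArg (trc n) (euler_fin V)
  rw [map_mul, map_mul, hD, hP V h, hP (2 * V) (by omega)] at h1
  have hu : IsUnit (trc n (PhiS n)) := by
    apply IsUnit.map
    apply isUnit_prod
    intro k
    simp
  exact hu.mul_eq_right.1 h1

lemma box_cong (t' m n L : ℕ) (hm : 1 ≤ m) (ht' : 0 < t') (hL : 3 * n + m + 1 ≤ L) (y : ℂ) :
    trc n (∏ ρ : Fin t', runF (2 * t') L ρ y m) =
    trc n (∏ k ∈ Finset.range n,
      ((1 - X ^ (2 * (k + 1) * (2 * t'))) ^ t' * (1 + X ^ (k + 1) : PowerSeries ℂ)⁻¹ *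
        (1 - PowerSeries.C (R := ℂ) (y ^ (2 * (k + 1))) * X ^ (2 * (k + 1) * (2 * t')))
          ^ ((m * m - 1) * t'))) := by
  have hq : ∀ y : ℂ, Polynomial.aeval (qv (2 * t') y) (Phi n) = ∏ k ∈ Finset.range n,
      (1 - PowerSeries.C (R := ℂ) (y ^ (2 * (k + 1))) * X ^ (2 * (k + 1) * (2 * t'))) := by
    intro y
    unfold Phi qv
    rw [map_prod]
    apply Finset.prod_congr rfl
    intro k _
    rw [map_sub, map_one, map_pow, Polynomial.aeval_X, mul_pow, ← map_pow, ← pow_mul, ← pow_mul]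
    congr 3
    ring
  have h1 : ∏ ρ : Fin t', trc n (theta (2 * t') L ρ) =
      trc n (Odd' (2 * t' * L)) * trc n (Polynomial.aeval (qv (2 * t') 1) (Phi n)) ^ t' := by
    rw [← runF_odd, map_prod]
    rw [show trc n (Polynomial.aeval (qv (2 * t') 1) (Phi n)) ^ t' =
      ∏ _ρ : Fin t', trc n (Polynomial.aeval (qv (2 * t') 1) (Phi n)) by simp,
      ← Finset.prod_mul_distrib]
    apply Finset.prod_congr rfl
    intro ρ _
    rw [← runF_zero (2 * t') L ρ (by omega) n (by omega), map_mul]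
  have h2 : trc n (∏ k ∈ Finset.range n, (1 + X ^ (k + 1) : PowerSeries ℂ)⁻¹) =
      trc n (Odd' (2 * t' * L)) := by
    have e1 := euler_cong n (2 * t' * L) (by nlinarith)
    have e2 : trc n (Dis n) * trc n (∏ k ∈ Finset.range n, (1 + X ^ (k + 1) : PowerSeries ℂ)⁻¹) = 1 := by
      rw [← map_mul, Dis, ← Finset.prod_mul_distrib, Finset.prod_eq_one, map_one]
      intro k _
      apply PowerSeries.mul_inv_cancel
      simp
    calc _ = (trc n (Odd' (2 * t' * L)) * trc n (Dis n)) *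
          trc n (∏ k ∈ Finset.range n, (1 + X ^ (k + 1) : PowerSeries ℂ)⁻¹) := by rw [e1, one_mul]
      _ = _ := by rw [mul_assoc, e2, mul_one]
  rw [Finset.prod_mul_distrib, Finset.prod_mul_distrib, map_mul, map_mul, h2, Finset.prod_pow,
    Finset.prod_pow, ← hq]
  have h3 : ∏ k ∈ Finset.range n, (1 - X ^ (2 * (k + 1) * (2 * t')) : PowerSeries ℂ) =
      Polynomial.aeval (qv (2 * t') 1) (Phi n) := by
    rw [hq]
    simp
  rw [h3, map_prod, map_pow, mul_comm (trc n _ ^ t'), ← h1, pow_mul, map_pow, map_pow]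
  rw [show (trc n (Polynomial.aeval (qv (2 * t') y) (Phi n)) ^ (m * m - 1)) ^ t' =
      ∏ _ρ : Fin t', (trc n (Polynomial.aeval (qv (2 * t') y) (Phi n))) ^ (m * m - 1) by simp,
      ← Finset.prod_mul_distrib]
  apply Finset.prod_congr rfl
  intro ρ _
  rw [runF_main (2 * t') L ρ (by omega) y m n hm hL, map_mul, map_pow]

end partJ


section partK

instance instT2PS : T2Space (PowerSeries ℂ) := PowerSeries.WithPiTopology.instT2Space ℂ

lemma tendsto_ps {ι : Type*} {F : Filter ι} (f : ι → PowerSeries ℂ) (a : PowerSeries ℂ) :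
    Filter.Tendsto f F (nhds a) ↔
      ∀ d, Filter.Tendsto (fun i => coeff d (f i)) F (nhds (coeff d a)) :=
  PowerSeries.WithPiTopology.tendsto_iff_coeff_tendsto ℂ f F a

lemma hasSum_ps {ι : Type*} (f : ι → PowerSeries ℂ) (a : PowerSeries ℂ) :
    HasSum f a ↔ ∀ d, HasSum (fun i => coeff d (f i)) (coeff d a) :=
  PowerSeries.WithPiTopology.hasSum_iff_hasSum_coeff ℂ

lemma coeff_tsum_fin {ι : Type*} (f : ι → PowerSeries ℂ) (F : ℕ → Finset ι)
    (hF : ∀ d i, i ∉ F d → coeff d (f i) = 0) (n : ℕ) :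
    coeff n (∑' i, f i) = ∑ i ∈ F n, coeff n (f i) := by
  have h : HasSum f (PowerSeries.mk (fun d => ∑ i ∈ F d, coeff d (f i))) := by
    rw [hasSum_ps]
    intro d
    rw [coeff_mk]
    exact hasSum_sum_of_ne_finset_zero (fun i hi => hF d i hi)
  rw [h.tsum_eq, coeff_mk]

lemma coeff_eq_of_trc {n : ℕ} {a b : PowerSeries ℂ} (h : trc n a = trc n b) :
    coeff n a = coeff n b := by
  rw [trc_eq, PowerSeries.X_pow_dvd_iff] at h
  have := h n (by omega)
  rwa [map_sub, sub_eq_zero] at this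

lemma trc_mono {n d : ℕ} (h : n ≤ d) {a b : PowerSeries ℂ} (hab : trc d a = trc d b) :
    trc n a = trc n b := by
  rw [trc_eq] at *
  exact (pow_dvd_pow _ (by omega)).trans hab

lemma coeff_tprod_fin (f : ℕ → PowerSeries ℂ) (hf : ∀ n k, n ≤ k → trc n (f k) = 1) (n : ℕ) :
    coeff n (∏' k, f k) = coeff n (∏ k ∈ Finset.range n, f k) := by
  have h : HasProd f (PowerSeries.mk (fun d => coeff d (∏ k ∈ Finset.range d, f k))) := by
    show Filter.Tendsto _ _ _
    rw [tendsto_ps]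
    intro d
    rw [coeff_mk]
    apply tendsto_const_nhds.congr'
    rw [SummationFilter.unconditional_filter]
    filter_upwards [Filter.eventually_ge_atTop (Finset.range d)] with s hs
    apply coeff_eq_of_trc
    rw [← Finset.prod_sdiff hs, map_mul, map_prod (trc d) f (s \ _),
      Finset.prod_eq_one (s := s \ _) (f := fun k => trc d (f k)), one_mul]
    intro k hk
    apply hf
    simpa using (Finset.mem_sdiff.1 hk).2
  rw [h.tprod_eq, coeff_mk]

lemma coeff_cpow {f : PowerSeries ℂ} (hf : X ∣ f - 1) (w : ℂ) (d : ℕ) :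
    coeff d (cpow f w) = ∑ k ∈ Finset.range (d + 1), cchoose w k * coeff d ((f - 1) ^ k) := by
  unfold cpow
  rw [coeff_tsum_fin _ (fun d => Finset.range (d + 1))]
  · simp only [PowerSeries.coeff_C_mul]
  · intro d k hk
    rw [PowerSeries.coeff_C_mul, PowerSeries.X_pow_dvd_iff.1 (pow_dvd_pow_of_dvd hf k) d, mul_zero]
    simpa using hk

lemma cchoose_nat (m k : ℕ) : cchoose m k = (m.choose k : ℂ) := by
  unfold cchoose
  rw [← descPochhammer_eval_eq_prod_range, descPochhammer_eval_eq_descFactorial,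
    Nat.descFactorial_eq_factorial_mul_choose]
  have : (k.factorial : ℂ) ≠ 0 := by exact_mod_cast k.factorial_ne_zero
  push_cast
  field_simp

lemma cpow_nat {f : PowerSeries ℂ} (hf : X ∣ f - 1) (m : ℕ) : cpow f m = f ^ m := by
  ext d
  rw [coeff_cpow hf]
  have h0 : ∀ k, d < k → coeff d ((f - 1) ^ k) = 0 := by
    intro k hk
    exact PowerSeries.X_pow_dvd_iff.1 (pow_dvd_pow_of_dvd hf k) d hk
  have h1 : f ^ m = ∑ k ∈ Finset.range (m + 1), PowerSeries.C (R := ℂ) (m.choose k) * (f - 1) ^ k := by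
    conv_lhs => rw [show f = (f - 1) + 1 by ring]
    rw [add_pow]
    apply Finset.sum_congr rfl
    intro k _
    simp [mul_comm]
  rw [h1, map_sum]
  simp only [PowerSeries.coeff_C_mul, cchoose_nat]
  rw [Finset.sum_subset (Finset.range_mono (show d + 1 ≤ d + m + 1 by omega)),
    Finset.sum_subset (Finset.range_mono (show m + 1 ≤ d + m + 1 by omega))]
  · intro k _ hk
    rw [Nat.choose_eq_zero_of_lt (by simpa using hk)]
    simp
  · intro k _ hk
    rw [h0 k (by simpa using hk), mul_zero]

/-- polynomial functions -/
def PolyF : Subring (ℂ → ℂ) := (RingHom.pi (fun z : ℂ => Polynomial.evalRingHom z)).range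

lemma polyF_iff (g : ℂ → ℂ) : g ∈ PolyF ↔ ∃ p : Polynomial ℂ, ∀ z, p.eval z = g z := by
  unfold PolyF
  rw [RingHom.mem_range]
  constructor
  · rintro ⟨p, hp⟩
    exact ⟨p, fun z => congrFun hp z⟩
  · rintro ⟨p, hp⟩
    exact ⟨p, funext hp⟩

lemma polyF_const (c : ℂ) : (fun _ => c) ∈ PolyF :=
  (polyF_iff _).2 ⟨Polynomial.C c, fun z => by simp⟩

lemma polyF_id : (fun z => z) ∈ PolyF :=
  (polyF_iff _).2 ⟨Polynomial.X, fun z => by simp⟩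

lemma polyF_mul {f g : ℂ → ℂ} (hf : f ∈ PolyF) (hg : g ∈ PolyF) : (fun z => f z * g z) ∈ PolyF :=
  PolyF.mul_mem hf hg

lemma polyF_sub {f g : ℂ → ℂ} (hf : f ∈ PolyF) (hg : g ∈ PolyF) : (fun z => f z - g z) ∈ PolyF :=
  PolyF.sub_mem hf hg

lemma polyF_sum {ι : Type*} {f : ι → ℂ → ℂ} (s : Finset ι) (hf : ∀ i ∈ s, f i ∈ PolyF) :
    (fun z => ∑ i ∈ s, f i z) ∈ PolyF := by
  have := PolyF.sum_mem hf
  convert this using 1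
  funext z
  simp

lemma polyF_prod {ι : Type*} {f : ι → ℂ → ℂ} (s : Finset ι) (hf : ∀ i ∈ s, f i ∈ PolyF) :
    (fun z => ∏ i ∈ s, f i z) ∈ PolyF := by
  have := PolyF.prod_mem hf
  convert this using 1
  funext z
  simp

lemma polyF_ext {f g : ℂ → ℂ} (hf : f ∈ PolyF) (hg : g ∈ PolyF)
    (h : ∀ m : ℕ, 1 ≤ m → f m = g m) (z : ℂ) : f z = g z := by
  obtain ⟨p, hp⟩ := (polyF_iff f).1 hf
  obtain ⟨q, hq⟩ := (polyF_iff g).1 hg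
  have : p = q := by
    apply Polynomial.eq_of_infinite_eval_eq
    have hinf : (Set.range (fun m : ℕ => ((m + 1 : ℕ) : ℂ))).Infinite :=
      Set.infinite_range_of_injective (fun a b hab => by
        have := Nat.cast_injective (R := ℂ) hab
        omega)
    apply hinf.mono
    rintro _ ⟨m, rfl⟩
    show p.eval _ = q.eval _
    rw [hp, hq]
    exact h (m + 1) (by omega)
  rw [← hp, ← hq, this]

lemma polyS_mul {f g : ℂ → PowerSeries ℂ} (hf : ∀ d, (fun z => coeff d (f z)) ∈ PolyF)
    (hg : ∀ d, (fun z => coeff d (g z)) ∈ PolyF) (d : ℕ) :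
    (fun z => coeff d (f z * g z)) ∈ PolyF := by
  simp only [PowerSeries.coeff_mul]
  apply polyF_sum
  intro i _
  exact polyF_mul (hf _) (hg _)

lemma polyS_prod (f : ℕ → ℂ → PowerSeries ℂ) (hf : ∀ k d, (fun z => coeff d (f k z)) ∈ PolyF)
    (K d : ℕ) : (fun z => coeff d (∏ k ∈ Finset.range K, f k z)) ∈ PolyF := by
  induction K generalizing d with
  | zero =>
    simp only [Finset.range_zero, Finset.prod_empty]
    exact polyF_const _
  | succ K ih =>
    simp only [Finset.prod_range_succ]
    exact polyS_mul ih (hf K) d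

lemma polyF_cchoose {g : ℂ → ℂ} (hg : g ∈ PolyF) (k : ℕ) : (fun z => cchoose (g z) k) ∈ PolyF := by
  unfold cchoose
  simp only [div_eq_mul_inv]
  apply polyF_mul _ (polyF_const _)
  apply polyF_prod
  intro i _
  exact polyF_sub hg (polyF_const _)

end partK

theorem genscpair_t_even (t' : ℕ) (ht' : 0 < t') (y z : ℂ) :
    ∑' μ : {μ : YoungDiagram // μ.transpose = μ},
      PowerSeries.C (R := ℂ) ((-1) ^ durfee μ.1 *
        ∏ c ∈ μ.1.cells.filter (fun c => (2 * t') ∣ hookLen μ.1 c),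
          (y - y * z * (2 * t' : ℕ) / ((hookLen μ.1 c : ℂ) * eps c))) * X ^ μ.1.card
      =
    ∏' k : ℕ,
      ((1 - X ^ (2 * (k + 1) * (2 * t'))) ^ t' * (1 + X ^ (k + 1) : PowerSeries ℂ)⁻¹ *
        cpow (1 - PowerSeries.C (R := ℂ) (y ^ (2 * (k + 1))) * X ^ (2 * (k + 1) * (2 * t')))
          ((z ^ 2 - 1) * (t' : ℂ))) := by
  show ∑' μ : {μ : YoungDiagram // μ.transpose = μ}, Wt (2 * t') y z μ.1 = _
  -- the left side
  have hL : ∀ (z : ℂ) (L n : ℕ), n ≤ L →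
      ∀ F : Finset {μ : YoungDiagram // μ.transpose = μ},
      (∀ μ : {μ : YoungDiagram // μ.transpose = μ}, μ.1.rowLen 0 ≤ 2 * t' * L → μ ∈ F) →
      coeff n (∑' μ : {μ : YoungDiagram // μ.transpose = μ}, Wt (2 * t') y z μ.1) =
        ∑ μ ∈ F, coeff n (Wt (2 * t') y z μ.1) := by
    intro z L n hn F hF
    have hex := fun d => box_sum (t' := t') (L := d) ht'
    choose G hG1 _ using hex
    have hz : ∀ (L d : ℕ), d ≤ L → ∀ μ : {μ : YoungDiagram // μ.transpose = μ},
        ¬ μ.1.rowLen 0 ≤ 2 * t' * L → coeff d (Wt (2 * t') y z μ.1) = 0 := by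
      intro L d hd μ hμ
      have h1 := rowLen_le_card μ.1
      have h2 : d < μ.1.card := by nlinarith
      unfold Wt
      rw [PowerSeries.coeff_C_mul, PowerSeries.coeff_X_pow, if_neg (by omega), mul_zero]
    have key := coeff_tsum_fin
      (fun μ : {μ : YoungDiagram // μ.transpose = μ} => Wt (2 * t') y z μ.1)
      (fun d => if d = n then F else G d) (by
        intro d μ hμ
        by_cases hd : d = n
        · rw [if_pos hd] at hμ
          exact hz L d (by omega) μ (fun h => hμ (hF μ h))
        · rw [if_neg hd] at hμ
          exact hz d d le_rfl μ (fun h => hμ (hG1 d μ h))) n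
    rwa [if_pos rfl] at key
  -- the right side
  have hX : ∀ k : ℕ, X ^ (k + 1) ∣
      (1 - PowerSeries.C (R := ℂ) (y ^ (2 * (k + 1))) * X ^ (2 * (k + 1) * (2 * t'))) - 1 := by
    intro k
    rw [show (1 - PowerSeries.C (R := ℂ) (y ^ (2 * (k + 1))) * X ^ (2 * (k + 1) * (2 * t'))) - 1 =
      X ^ (2 * (k + 1) * (2 * t')) * (- PowerSeries.C (R := ℂ) (y ^ (2 * (k + 1)))) by ring]
    apply Dvd.dvd.mul_right
    apply pow_dvd_pow
    nlinarith
  have hX1 : ∀ k : ℕ, X ∣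
      (1 - PowerSeries.C (R := ℂ) (y ^ (2 * (k + 1))) * X ^ (2 * (k + 1) * (2 * t'))) - 1 :=
    fun k => (dvd_pow_self _ (by omega)).trans (hX k)
  have hR : ∀ (z : ℂ) (n : ℕ), coeff n (∏' k : ℕ,
      ((1 - X ^ (2 * (k + 1) * (2 * t'))) ^ t' * (1 + X ^ (k + 1) : PowerSeries ℂ)⁻¹ *
        cpow (1 - PowerSeries.C (R := ℂ) (y ^ (2 * (k + 1))) * X ^ (2 * (k + 1) * (2 * t')))
          ((z ^ 2 - 1) * (t' : ℂ)))) = coeff n (∏ k ∈ Finset.range n,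
      ((1 - X ^ (2 * (k + 1) * (2 * t'))) ^ t' * (1 + X ^ (k + 1) : PowerSeries ℂ)⁻¹ *
        cpow (1 - PowerSeries.C (R := ℂ) (y ^ (2 * (k + 1))) * X ^ (2 * (k + 1) * (2 * t')))
          ((z ^ 2 - 1) * (t' : ℂ)))) := by
    intro z n
    apply coeff_tprod_fin
    intro n k hk
    have h1 : trc n (1 - X ^ (2 * (k + 1) * (2 * t'))) = 1 := by
      rw [map_sub, trc_zero (by nlinarith), map_one, sub_zero]
    have h2 : trc n (1 + X ^ (k + 1) : PowerSeries ℂ)⁻¹ = 1 := by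
      have : trc n (1 + X ^ (k + 1) : PowerSeries ℂ) = 1 := by
        rw [map_add, trc_zero (by omega), map_one, add_zero]
      have h3 := congrArg (trc n) (PowerSeries.mul_inv_cancel (1 + X ^ (k + 1) : PowerSeries ℂ)
        (by simp))
      rwa [map_mul, this, one_mul, map_one] at h3
    have h3 : trc n (cpow (1 - PowerSeries.C (R := ℂ) (y ^ (2 * (k + 1))) *
        X ^ (2 * (k + 1) * (2 * t'))) ((z ^ 2 - 1) * (t' : ℂ))) = trc n 1 := by
      rw [trc_eq, PowerSeries.X_pow_dvd_iff]
      intro d hd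
      rw [map_sub, coeff_cpow (hX1 k), Finset.sum_range_succ', Finset.sum_eq_zero]
      · simp [cchoose]
      · intro i _
        have : X ^ (k + 1) ∣ ((1 - PowerSeries.C (R := ℂ) (y ^ (2 * (k + 1))) *
          X ^ (2 * (k + 1) * (2 * t'))) - 1) ^ (i + 1) := (hX k).trans (dvd_pow_self _ (by omega))
        rw [PowerSeries.X_pow_dvd_iff.1 this d (by omega), mul_zero]
    rw [map_mul, map_mul, map_pow, h1, h2, h3, map_one]
    simp
  ext n
  obtain ⟨F, hF, _⟩ := box_sum (t' := t') (L := n) ht'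
  rw [hL z n n le_rfl F hF, hR]
  apply polyF_ext (f := fun z => ∑ μ ∈ F, coeff n (Wt (2 * t') y z μ.1))
    (g := fun z => coeff n (∏ k ∈ Finset.range n,
      ((1 - X ^ (2 * (k + 1) * (2 * t'))) ^ t' * (1 + X ^ (k + 1) : PowerSeries ℂ)⁻¹ *
        cpow (1 - PowerSeries.C (R := ℂ) (y ^ (2 * (k + 1))) * X ^ (2 * (k + 1) * (2 * t')))
          ((z ^ 2 - 1) * (t' : ℂ)))))
  · apply polyF_sum
    intro μ _
    unfold Wt
    simp only [PowerSeries.coeff_C_mul]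
    apply polyF_mul _ (polyF_const _)
    apply polyF_mul (polyF_const _)
    apply polyF_prod
    intro c _
    apply polyF_sub (polyF_const _)
    simp only [div_eq_mul_inv]
    exact polyF_mul (polyF_mul (polyF_mul (polyF_const _) polyF_id) (polyF_const _)) (polyF_const _)
  · apply polyS_prod
    intro k d
    apply polyS_mul
    · intro d
      exact polyF_const _
    · intro d
      simp only [coeff_cpow (hX1 k)]
      apply polyF_sum
      intro i _
      apply polyF_mul _ (polyF_const _)
      apply polyF_cchoose
      simp only [sq]
      exact polyF_mul (polyF_sub (polyF_mul polyF_id polyF_id) (polyF_const _)) (polyF_const _)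
  · intro m hm
    obtain ⟨F', hF', hs⟩ := box_sum (t' := t') (L := 3 * n + m + 1) ht'
    rw [← hL m n n le_rfl F hF, hL m (3 * n + m + 1) n (by omega) F' hF', ← map_sum, hs]
    apply coeff_eq_of_trc
    rw [box_cong t' m n _ hm ht' le_rfl]
    congr 1
    apply Finset.prod_congr rfl
    intro k _
    congr 1
    rw [← cpow_nat (hX1 k)]
    congr 1
    have : 1 ≤ m * m := by nlinarith
    push_cast [Nat.cast_sub this]
    ring
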